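/- arXiv:1705.03673 — 3 statements merged into one kernel-verified Lean document; each statement's English description precedes it below -/
import Mathlib

section
/- Let G be an undirected cubic graph with n vertices, fix a vertex x₁ of G and two distinct neighbors x₂, x₃ of x₁, and let G' be the graph of the path construction. Then G has a Hamiltonian cycle if and only if G' admits n − 1 s-t paths sharing no edge. -/
namespace PaperRCA

/-- A walk in an undirected (simple) graph `G`: a nonempty list of vertices in which
consecutive vertices are adjacent. -/
def IsGWalk {V : Type*} (G : SimpleGraph V) (w : List V) : Prop :=
  w ≠ [] ∧ w.Chain' G.Adj

/-- The list of (unordered) edges of a walk. -/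
def walkEdges {V : Type*} (w : List V) : List (Sym2 V) :=
  (w.zip w.tail).map (fun q => s(q.1, q.2))

/-- An edge `e` is shared by the family of walks `W` if it occurs at the same
position in two distinct walks of the family. -/
def SharedEdge {V : Type*} {p : ℕ} (W : Fin p → List V) (e : Sym2 V) : Prop :=
  ∃ i j : Fin p, i ≠ j ∧ ∃ r : ℕ,
    (walkEdges (W i))[r]? = some e ∧ (walkEdges (W j))[r]? = some e

/-- Vertices of the path construction for a cubic graph on `n` vertices: a copy of
the original vertices, the new vertices `s, t, v, w`, and for each
`m ∈ {4, …, n+1}` the internal vertices of an `m`-chain connecting `s` and `w`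
(chain index `c : Fin (n-2)` corresponds to the `(c+4)`-chain, which has `c+3`
internal vertices). -/
inductive PCV (n : ℕ) where
  | orig (x : Fin n) : PCV n
  | s : PCV n
  | t : PCV n
  | v : PCV n
  | w : PCV n
  | ch (c : Fin (n - 2)) (r : Fin ((c : ℕ) + 3)) : PCV n

/-- Base edge relation of the path construction (the graph `G'` is its symmetric
closure, as a simple graph). -/
def PCRel {n : ℕ} (G : SimpleGraph (Fin n)) (x₁ x₂ x₃ : Fin n) :
    PCV n → PCV n → Prop
  | .orig a, .orig b => G.Adj a b
  | .s, .v => True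
  | .v, .orig a => a = x₁
  | .orig a, .w => a = x₂ ∨ a = x₃
  | .w, .t => True
  | .s, .ch _ r => (r : ℕ) = 0
  | .ch c r, .ch c' r' => (c : ℕ) = (c' : ℕ) ∧ (r' : ℕ) = (r : ℕ) + 1
  | .ch c r, .w => (r : ℕ) = (c : ℕ) + 2
  | _, _ => False

theorem exists_hamiltonian_list_of_cycle_snd {n : ℕ} {G : SimpleGraph (Fin n)} {x y : Fin n}
    (c : G.Walk x x) (hc : c.IsHamiltonianCycle) (hy : c.snd = y) :
    ∃ l : List (Fin n), l.Nodup ∧ l.length = n ∧ l.IsChain G.Adj ∧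
      l.head? = some x ∧ l.getLast? = some y := by
  subst hy
  have hp := hc.isHamiltonian_tail
  refine ⟨c.tail.reverse.support, ?_, ?_, SimpleGraph.Walk.isChain_adj_support _, ?_, ?_⟩
  · rw [SimpleGraph.Walk.support_reverse, List.nodup_reverse]; exact hp.isPath.support_nodup
  · simpa using hp.length_support
  · rw [List.head?_eq_some_head (SimpleGraph.Walk.support_ne_nil _)]; simp
  · rw [List.getLast?_eq_some_getLast (SimpleGraph.Walk.support_ne_nil _)]; simp

theorem exists_hamiltonian_list_of_cycle {n : ℕ} {G : SimpleGraph (Fin n)} [DecidableRel G.Adj]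
    {x₁ x₂ x₃ : Fin n} (hdeg : G.degree x₁ = 3) (h₂ : G.Adj x₁ x₂) (h₃ : G.Adj x₁ x₃)
    (h₂₃ : x₂ ≠ x₃) {a : Fin n} (c : G.Walk a a) (hc : c.IsHamiltonianCycle) :
    ∃ l : List (Fin n), l.Nodup ∧ l.length = n ∧ l.IsChain G.Adj ∧
      l.head? = some x₁ ∧ ∃ y, (y = x₂ ∨ y = x₃) ∧ l.getLast? = some y := by
  have hd := hc.rotate (hc.mem_support x₁)
  set d := c.rotate x₁ (hc.mem_support x₁)
  have hne : d.snd ≠ d.penultimate := hd.isCycle.snd_ne_penultimate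
  have hs : G.Adj x₁ d.snd := d.adj_snd hd.isCycle.not_nil
  have hp : G.Adj x₁ d.penultimate := (d.adj_penultimate hd.isCycle.not_nil).symm
  have hr : d.reverse.IsHamiltonianCycle := by
    rw [SimpleGraph.Walk.isHamiltonianCycle_iff_isCycle_and_length_eq] at hd ⊢
    simpa using hd
  have key : (d.snd = x₂ ∨ d.snd = x₃) ∨ (d.penultimate = x₂ ∨ d.penultimate = x₃) := by
    by_contra! h
    have hcard : ({x₂, x₃, d.snd, d.penultimate} : Finset (Fin n)).card = 4 := by
      rw [Finset.card_insert_of_notMem, Finset.card_insert_of_notMem, Finset.card_pair hne] <;>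
        grind
    have hsub : ({x₂, x₃, d.snd, d.penultimate} : Finset (Fin n)) ⊆ G.neighborFinset x₁ := by
      intro z hz
      simp only [Finset.mem_insert, Finset.mem_singleton] at hz
      rw [SimpleGraph.mem_neighborFinset]
      grind
    have := Finset.card_le_card hsub
    rw [SimpleGraph.card_neighborFinset_eq_degree] at this
    omega
  rcases key with h | h
  · obtain ⟨l, h1, h2, h3, h4, h5⟩ := exists_hamiltonian_list_of_cycle_snd d hd rfl
    exact ⟨l, h1, h2, h3, h4, _, h, h5⟩
  · obtain ⟨l, h1, h2, h3, h4, h5⟩ :=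
      exists_hamiltonian_list_of_cycle_snd d.reverse hr d.snd_reverse
    exact ⟨l, h1, h2, h3, h4, _, h, h5⟩

theorem exists_hamiltonianCycle_of_list {n : ℕ} {G : SimpleGraph (Fin n)} (hn : 3 ≤ n)
    {x y : Fin n} (hyx : G.Adj y x) {l : List (Fin n)} (hnd : l.Nodup) (hlen : l.length = n)
    (hch : l.IsChain G.Adj) (hx : l.head? = some x) (hy : l.getLast? = some y) :
    ∃ (a : Fin n) (c : G.Walk a a), c.IsHamiltonianCycle := by
  have hne : l ≠ [] := by rintro rfl; simp at hx
  obtain rfl : l.head hne = x := by simpa [List.head?_eq_some_head hne] using hx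
  obtain rfl : l.getLast hne = y := by simpa [List.getLast?_eq_some_getLast hne] using hy
  refine ⟨_, .cons hyx (.ofSupport l hne hch), ?_⟩
  have hl : (SimpleGraph.Walk.ofSupport l hne hch).length = n - 1 := by
    rw [SimpleGraph.Walk.length_ofSupport, hlen]
  rw [SimpleGraph.Walk.isHamiltonianCycle_iff_isCycle_and_length_eq,
    SimpleGraph.Walk.isCycle_iff_isPath_tail_and_le_length]
  simp only [SimpleGraph.Walk.length_cons, hl, Fintype.card_fin]
  refine ⟨⟨?_, by omega⟩, by omega⟩
  simp [SimpleGraph.Walk.isPath_def, SimpleGraph.Walk.support_ofSupport, hnd]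

theorem walkEdges_getElem?_eq_some {V : Type*} {l : List V} {r : ℕ} {e : Sym2 V} :
    (walkEdges l)[r]? = some e ↔
      ∃ a b, l[r]? = some a ∧ l[r + 1]? = some b ∧ e = s(a, b) := by
  simp only [walkEdges, List.getElem?_map, List.getElem?_zip_eq_some, Option.map_eq_some_iff,
    Prod.exists, List.getElem?_tail, and_assoc, eq_comm (a := e)]

/-- The graph `G'` of the path construction. -/
abbrev pathConstruction {n : ℕ} (G : SimpleGraph (Fin n)) (x₁ x₂ x₃ : Fin n) :
    SimpleGraph (PCV n) :=
  SimpleGraph.fromRel (PCRel G x₁ x₂ x₃)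

/-- The index of the `s`-`w` branch a vertex lies on, the copy of `G` being branch `n - 2`. -/
def branch {n : ℕ} : PCV n → Option ℕ
  | .orig _ => some (n - 2)
  | .v => some (n - 2)
  | .ch c _ => some c
  | _ => none

/-- The vertices strictly between `s` and `w` on the `i`-th path of the family. -/
def innerPath {n : ℕ} (l : List (Fin n)) (i : Fin (n - 1)) : List (PCV n) :=
  if h : (i : ℕ) < n - 2 then (List.finRange ((i : ℕ) + 3)).map (PCV.ch ⟨i, h⟩)
  else PCV.v :: l.map PCV.orig

/-- The `i`-th path of the family determined by a list of vertices of `G`. -/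
def fullPath {n : ℕ} (l : List (Fin n)) (i : Fin (n - 1)) : List (PCV n) :=
  PCV.s :: (innerPath l i ++ [PCV.w, PCV.t])

section family

variable {n : ℕ} {l : List (Fin n)} {i : Fin (n - 1)}

theorem length_innerPath (hlen : l.length = n) : (innerPath l i).length = i + 3 := by
  unfold innerPath
  split
  · simp
  · simp; omega

theorem branch_of_mem_innerPath {u : PCV n} (hu : u ∈ innerPath l i) : branch u = some (i : ℕ) := by
  unfold innerPath at hu
  split at hu
  · simp only [List.mem_map] at hu
    obtain ⟨r, -, rfl⟩ := hu
    rfl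
  · have : (i : ℕ) = n - 2 := by omega
    simp only [List.mem_cons, List.mem_map] at hu
    obtain rfl | ⟨r, -, rfl⟩ := hu <;> simp [branch, this]

theorem branch_of_mem_fullPath {u : PCV n} (hu : u ∈ fullPath l i) :
    branch u = none ∨ branch u = some (i : ℕ) := by
  simp only [fullPath, List.mem_cons, List.mem_append, List.not_mem_nil, or_false] at hu
  obtain rfl | hu | rfl | rfl := hu
  · exact .inl rfl
  · exact .inr (branch_of_mem_innerPath hu)
  · exact .inl rfl
  · exact .inl rfl

theorem nodup_innerPath (hnd : l.Nodup) : (innerPath l i).Nodup := by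
  unfold innerPath
  split
  · exact (List.nodup_finRange _).map fun a b h => by simpa using h
  · simp only [List.nodup_cons, List.mem_map, reduceCtorEq, and_false, exists_false,
      not_false_eq_true, true_and]
    exact hnd.map fun a b h => by simpa using h

theorem nodup_fullPath (hnd : l.Nodup) : (fullPath l i).Nodup := by
  have key : ∀ u : PCV n, branch u = none → u ∉ innerPath l i := fun u hu h => by
    simp [branch_of_mem_innerPath h] at hu
  simp [fullPath, List.nodup_append, nodup_innerPath hnd, key PCV.s rfl]
  exact fun a ha => ⟨fun h => key PCV.w rfl (h ▸ ha), fun h => key PCV.t rfl (h ▸ ha)⟩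

theorem isChain_fullPath {G : SimpleGraph (Fin n)} {x₁ x₂ x₃ y : Fin n} (hy : y = x₂ ∨ y = x₃)
    (hch : l.IsChain G.Adj) (hx : l.head? = some x₁) (hl : l.getLast? = some y) :
    (fullPath l i).IsChain (pathConstruction G x₁ x₂ x₃).Adj := by
  unfold fullPath innerPath
  split
  case isTrue h =>
    rw [List.isChain_cons, List.isChain_append]
    refine ⟨?_, ?_, by simp [PCRel], ?_⟩
    · simp [List.finRange_succ, PCRel]
    · rw [List.isChain_iff_getElem]
      intro k hk
      simp [PCRel]
    · simp [List.getLast?_map, List.finRange_succ_last, PCRel]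
  case isFalse h =>
    rw [List.cons_append, List.isChain_cons_cons, List.isChain_cons, List.isChain_append]
    refine ⟨by simp [PCRel], ?_, ?_, by simp [PCRel], ?_⟩
    · simp [hx, PCRel]
    · rw [List.isChain_map]
      exact hch.imp fun a b hab => by simpa [PCRel, hab] using hab.ne
    · simp [hl, PCRel, hy]

theorem branch_edge_fullPath (hlen : l.length = n) {r : ℕ} {a b : PCV n}
    (ha : (fullPath l i)[r]? = some a) (hb : (fullPath l i)[r + 1]? = some b) :
    (branch a = some (i : ℕ) ∨ branch b = some (i : ℕ)) ∨ r = i + 4 := by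
  have hm := length_innerPath (i := i) hlen
  have inner : ∀ (k : ℕ) u, k < i + 3 → (fullPath l i)[k + 1]? = some u → branch u = some (i : ℕ) := by
    intro k u hk hu
    rw [fullPath, List.getElem?_cons_succ, List.getElem?_append_left (by omega)] at hu
    exact branch_of_mem_innerPath (List.mem_of_getElem? hu)
  obtain ⟨hr, -⟩ := List.getElem?_eq_some_iff.mp hb
  simp only [fullPath, List.length_cons, List.length_append, hm, List.length_nil] at hr
  by_cases h : r < i + 3
  · exact .inl (.inr (inner r b h hb))
  · by_cases h' : r = i + 4
    · exact .inr h'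
    · obtain rfl : r = i + 3 := by omega
      exact .inl (.inl (inner (i + 2) a (by omega) ha))

theorem eq_of_shared_fullPath (hlen : l.length = n) {j : Fin (n - 1)} {r : ℕ} {e : Sym2 (PCV n)}
    (hi : (walkEdges (fullPath l i))[r]? = some e)
    (hj : (walkEdges (fullPath l j))[r]? = some e) : i = j := by
  obtain ⟨a, b, ha, hb, rfl⟩ := walkEdges_getElem?_eq_some.mp hi
  obtain ⟨a', b', ha', hb', h⟩ := walkEdges_getElem?_eq_some.mp hj
  have h1 := branch_edge_fullPath hlen ha hb
  have h2 := branch_edge_fullPath hlen ha' hb'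
  have h3 := branch_of_mem_fullPath (List.mem_of_getElem? ha)
  have h4 := branch_of_mem_fullPath (List.mem_of_getElem? hb)
  have h5 := branch_of_mem_fullPath (List.mem_of_getElem? ha')
  have h6 := branch_of_mem_fullPath (List.mem_of_getElem? hb')
  rw [Fin.ext_iff]
  rw [Sym2.eq_iff] at h
  grind

end family

section analysis

variable {n : ℕ} {G : SimpleGraph (Fin n)} {x₁ x₂ x₃ : Fin n}

theorem eq_w_of_adj_t {u : PCV n} (h : (pathConstruction G x₁ x₂ x₃).Adj u .t) : u = .w := by
  cases u <;> simp_all [PCRel]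

theorem eq_of_adj_s {u : PCV n} (h : (pathConstruction G x₁ x₂ x₃).Adj .s u) :
    u = .v ∨ ∃ c r, u = .ch c r ∧ (r : ℕ) = 0 := by
  cases u <;> simp_all [PCRel]

theorem eq_of_adj_v {u : PCV n} (h : (pathConstruction G x₁ x₂ x₃).Adj .v u) :
    u = .s ∨ u = .orig x₁ := by
  cases u <;> simp_all [PCRel]

theorem eq_of_adj_orig {a : Fin n} {u : PCV n}
    (h : (pathConstruction G x₁ x₂ x₃).Adj (.orig a) u) :
    (∃ b, u = .orig b ∧ G.Adj a b) ∨ u = .v ∨ u = .w ∧ (a = x₂ ∨ a = x₃) := by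
  cases u <;> simp_all [PCRel, G.adj_comm]

theorem eq_of_adj_ch {c : Fin (n - 2)} {r : Fin ((c : ℕ) + 3)} {u : PCV n}
    (h : (pathConstruction G x₁ x₂ x₃).Adj (.ch c r) u) :
    u = .s ∨ (u = .w ∧ (r : ℕ) = c + 2) ∨
      ∃ r', u = .ch c r' ∧ ((r' : ℕ) = r + 1 ∨ (r : ℕ) = r' + 1) := by
  cases u with
  | ch c' r' =>
    have h' := ((SimpleGraph.fromRel_adj _ _ _).mp h).2
    simp only [PCRel] at h'
    obtain rfl : c' = c := by rw [Fin.ext_iff]; omega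
    exact .inr (.inr ⟨r', rfl, by omega⟩)
  | _ => simp_all [PCRel]

theorem tail_eq_of_isChain_w {l : List (PCV n)}
    (hch : (PCV.w :: l).IsChain (pathConstruction G x₁ x₂ x₃).Adj) (hnd : (PCV.w :: l).Nodup)
    (hlast : (PCV.w :: l).getLast? = some .t) : l = [.t] := by
  obtain rfl | ⟨l, u, rfl⟩ := l.eq_nil_or_concat
  · simp at hlast
  obtain rfl : u = .t := by simpa [List.getLast?_cons] using hlast
  obtain rfl | ⟨l, u, rfl⟩ := l.eq_nil_or_concat
  · rfl
  · simp only [List.isChain_cons, List.concat_eq_append, List.isChain_append] at hch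
    have := eq_w_of_adj_t (hch.2.2.2 u (by simp) .t (by simp))
    subst this
    simp at hnd

theorem length_of_isChain_ch (c : Fin (n - 2)) (l : List (PCV n)) (r : Fin ((c : ℕ) + 3))
    (hch : (PCV.ch c r :: l).IsChain (pathConstruction G x₁ x₂ x₃).Adj)
    (hnd : (PCV.ch c r :: l).Nodup) (hlast : (PCV.ch c r :: l).getLast? = some .t)
    (hs : PCV.s ∉ l) (hr : ∀ r' < r, PCV.ch c r' ∉ l) : l.length + r = c + 4 := by
  induction l generalizing r with
  | nil => simp at hlast
  | cons u l ih =>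
    rw [List.isChain_cons_cons] at hch
    rw [List.nodup_cons] at hnd
    rw [List.getLast?_cons_cons] at hlast
    obtain rfl | ⟨rfl, hrc⟩ | ⟨r', rfl, hrr | hrr⟩ := eq_of_adj_ch hch.1
    · simp at hs
    · have := tail_eq_of_isChain_w hch.2 hnd.2 hlast
      subst this
      simp
      omega
    · have := ih r' hch.2 hnd.2 hlast (fun h => hs (List.mem_cons_of_mem _ h)) fun q hq hmem => by
        obtain h | rfl : q < r ∨ q = r := by rw [Fin.lt_def, Fin.ext_iff]; omega
        · exact hr q h (List.mem_cons_of_mem _ hmem)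
        · exact hnd.1 (List.mem_cons_of_mem _ hmem)
      simp
      omega
    · exact absurd (List.mem_cons_self) (hr r' (by rw [Fin.lt_def]; omega))

theorem exists_list_of_isChain_orig (l : List (PCV n)) (a : Fin n)
    (hch : (PCV.orig a :: l).IsChain (pathConstruction G x₁ x₂ x₃).Adj)
    (hnd : (PCV.orig a :: l).Nodup) (hlast : (PCV.orig a :: l).getLast? = some .t)
    (hv : PCV.v ∉ l) :
    ∃ (m : List (Fin n)) (y : Fin n), PCV.orig a :: l = m.map PCV.orig ++ [.w, .t] ∧
      m.IsChain G.Adj ∧ m.head? = some a ∧ (y = x₂ ∨ y = x₃) ∧ m.getLast? = some y := by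
  induction l generalizing a with
  | nil => simp at hlast
  | cons u l ih =>
    rw [List.isChain_cons_cons] at hch
    rw [List.nodup_cons] at hnd
    rw [List.getLast?_cons_cons] at hlast
    obtain ⟨b, rfl, hab⟩ | rfl | ⟨rfl, ha⟩ := eq_of_adj_orig hch.1
    · obtain ⟨m, y, hm, hmch, hhead, hy, hmy⟩ :=
        ih b hch.2 hnd.2 hlast fun h => hv (List.mem_cons_of_mem _ h)
      refine ⟨a :: m, y, by simp [hm], ?_, rfl, hy, by simp [List.getLast?_cons, hmy]⟩
      rw [List.isChain_cons]
      exact ⟨by simp [hhead, hab], hmch⟩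
    · simp at hv
    · have := tail_eq_of_isChain_w hch.2 hnd.2 hlast
      subst this
      exact ⟨[a], a, rfl, .singleton a, rfl, ha, rfl⟩

theorem path_cases {p : List (PCV n)} (hch : p.IsChain (pathConstruction G x₁ x₂ x₃).Adj)
    (hnd : p.Nodup) (hhead : p.head? = some .s) (hlast : p.getLast? = some .t) :
    (∃ c : Fin (n - 2), p.length = c + 6) ∨
      ∃ (m : List (Fin n)) (y : Fin n), p.length = m.length + 4 ∧ m.Nodup ∧
        m.IsChain G.Adj ∧ m.head? = some x₁ ∧ (y = x₂ ∨ y = x₃) ∧ m.getLast? = some y := by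
  obtain _ | ⟨u, _ | ⟨u', l⟩⟩ := p
  · simp at hhead
  · simp_all
  obtain rfl : u = .s := by simpa using hhead
  rw [List.isChain_cons_cons] at hch
  rw [List.nodup_cons] at hnd
  rw [List.getLast?_cons_cons] at hlast
  obtain rfl | ⟨c, r, rfl, hr⟩ := eq_of_adj_s hch.1
  · right
    obtain _ | ⟨u, l⟩ := l
    · simp at hlast
    rw [List.isChain_cons_cons] at hch
    rw [List.nodup_cons (a := PCV.v)] at hnd
    rw [List.getLast?_cons_cons] at hlast
    obtain rfl | rfl := eq_of_adj_v hch.2.1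
    · simp at hnd
    obtain ⟨m, y, hm, hmch, hhead, hy, hmy⟩ := exists_list_of_isChain_orig l x₁ hch.2.2 hnd.2.2
      hlast fun h => hnd.2.1 (List.mem_cons_of_mem _ h)
    refine ⟨m, y, ?_, ?_, hmch, hhead, hy, hmy⟩
    · simp [hm]
    · have := hnd.2.2
      rw [hm] at this
      exact this.of_append_left.of_map
  · left
    refine ⟨c, ?_⟩
    have := length_of_isChain_ch c l r hch.2 hnd.2 hlast
      (fun h => hnd.1 (List.mem_cons_of_mem _ h)) fun r' h => by rw [Fin.lt_def] at h; omega
    simp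
    omega

theorem walkEdges_last {p : List (PCV n)} (hch : p.IsChain (pathConstruction G x₁ x₂ x₃).Adj)
    (hlast : p.getLast? = some .t) (hlen : 2 ≤ p.length) :
    (walkEdges p)[p.length - 2]? = some s(.w, .t) := by
  rw [List.getLast?_eq_getElem?] at hlast
  have h := hch.getElem (p.length - 2) (by omega)
  have h' : p.length - 2 + 1 = p.length - 1 := by omega
  refine walkEdges_getElem?_eq_some.mpr ⟨.w, .t, ?_, by rwa [h'], rfl⟩
  obtain ⟨_, ht⟩ := List.getElem?_eq_some_iff.mp hlast
  simp only [h', ht] at h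
  rw [List.getElem?_eq_some_iff]
  exact ⟨by omega, eq_w_of_adj_t h⟩

theorem length_injective_of_not_shared {k : ℕ} {P : Fin k → List (PCV n)}
    (hch : ∀ i, (P i).IsChain (pathConstruction G x₁ x₂ x₃).Adj)
    (hlast : ∀ i, (P i).getLast? = some .t) (hlen : ∀ i, 2 ≤ (P i).length)
    (hP : ∀ e, ¬ SharedEdge P e) : Function.Injective fun i => (P i).length := by
  intro i j hij
  simp only at hij
  by_contra hne
  refine hP s(.w, .t) ⟨i, j, hne, (P i).length - 2, walkEdges_last (hch i) (hlast i) (hlen i), ?_⟩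
  rw [hij]
  exact walkEdges_last (hch j) (hlast j) (hlen j)

end analysis

theorem exists_unshared_paths_of_list {n : ℕ} {G : SimpleGraph (Fin n)} {x₁ x₂ x₃ y : Fin n}
    {l : List (Fin n)} (hnd : l.Nodup) (hlen : l.length = n) (hch : l.IsChain G.Adj)
    (hx : l.head? = some x₁) (hy : y = x₂ ∨ y = x₃) (hl : l.getLast? = some y) :
    ∃ P : Fin (n - 1) → List (PCV n),
      (∀ i : Fin (n - 1), IsGWalk (pathConstruction G x₁ x₂ x₃) (P i) ∧
        (P i).Nodup ∧ (P i).head? = some PCV.s ∧ (P i).getLast? = some PCV.t) ∧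
      ∀ e : Sym2 (PCV n), ¬ SharedEdge P e := by
  refine ⟨fullPath l, fun i => ⟨⟨by simp [fullPath], isChain_fullPath hy hch hx hl⟩,
    nodup_fullPath hnd, rfl, by simp [fullPath, List.getLast?_cons]⟩, ?_⟩
  rintro e ⟨i, j, hij, r, hi, hj⟩
  exact hij (eq_of_shared_fullPath hlen hi hj)

theorem exists_list_of_unshared_paths {n : ℕ} (hn : 2 ≤ n) {G : SimpleGraph (Fin n)}
    {x₁ x₂ x₃ : Fin n} (h₂ : x₁ ≠ x₂) (h₃ : x₁ ≠ x₃) {P : Fin (n - 1) → List (PCV n)}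
    (hP : ∀ i : Fin (n - 1), IsGWalk (pathConstruction G x₁ x₂ x₃) (P i) ∧
      (P i).Nodup ∧ (P i).head? = some PCV.s ∧ (P i).getLast? = some PCV.t)
    (hshare : ∀ e : Sym2 (PCV n), ¬ SharedEdge P e) :
    ∃ (l : List (Fin n)) (y : Fin n), l.Nodup ∧ l.length = n ∧ l.IsChain G.Adj ∧
      l.head? = some x₁ ∧ (y = x₂ ∨ y = x₃) ∧ l.getLast? = some y := by
  have hcase i := path_cases (hP i).1.2 (hP i).2.1 (hP i).2.2.1 (hP i).2.2.2
  have hbound : ∀ i, 6 ≤ (P i).length ∧ (P i).length ≤ n + 4 := by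
    intro i
    obtain ⟨c, hc⟩ | ⟨m, y, hm, hnd, -, hhead, hy, hlast⟩ := hcase i
    · omega
    · have hle : m.length ≤ n := by simpa using hnd.length_le_card
      suffices 2 ≤ m.length by omega
      match m with
      | [] => simp at hhead
      | [a] => simp at hhead hlast; grind
      | _ :: _ :: _ => simp
  have hinj := length_injective_of_not_shared (fun i => (hP i).1.2) (fun i => (hP i).2.2.2)
    (fun i => by have := hbound i; omega) hshare
  let f : Fin (n - 1) → Fin (n - 1) := fun i =>
    ⟨(P i).length - 6, by have := hbound i; omega⟩
  have hf : Function.Injective f := fun i j hij => by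
    have hij' : (P i).length - 6 = (P j).length - 6 := congrArg Fin.val hij
    have := hbound i
    have := hbound j
    exact hinj (show (P i).length = (P j).length by omega)
  obtain ⟨i, hi⟩ := Finite.surjective_of_injective hf ⟨n - 2, by omega⟩
  have hi' : (P i).length - 6 = n - 2 := congrArg Fin.val hi
  have := hbound i
  obtain ⟨c, hc⟩ | ⟨m, y, hm, hnd, hch, hhead, hy, hlast⟩ := hcase i
  · omega
  · exact ⟨m, y, hnd, by omega, hch, hhead, hy, hlast⟩

/-- A cubic graph `G` on `n` vertices (with a fixed vertex `x₁` and
distinct neighbors `x₂, x₃` of it) has a Hamiltonian cycle iff the graph `G'` of the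
path construction admits `n - 1` `s`-`t` paths sharing no edge. -/
theorem stmt5 (n : ℕ) (G : SimpleGraph (Fin n)) [DecidableRel G.Adj]
    (hcubic : ∀ x : Fin n, G.degree x = 3)
    (x₁ x₂ x₃ : Fin n) (h₂ : G.Adj x₁ x₂) (h₃ : G.Adj x₁ x₃) (h₂₃ : x₂ ≠ x₃) :
    (∃ (a : Fin n) (c : G.Walk a a), c.IsHamiltonianCycle) ↔
    (∃ P : Fin (n - 1) → List (PCV n),
      (∀ i : Fin (n - 1), IsGWalk (SimpleGraph.fromRel (PCRel G x₁ x₂ x₃)) (P i) ∧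
        (P i).Nodup ∧ (P i).head? = some PCV.s ∧ (P i).getLast? = some PCV.t) ∧
      ∀ e : Sym2 (PCV n), ¬ SharedEdge P e) := by
  have hn : 3 < n := by
    have := G.degree_lt_card_verts x₁
    rwa [hcubic, Fintype.card_fin] at this
  constructor
  · rintro ⟨a, c, hc⟩
    obtain ⟨l, hnd, hlen, hch, hx, y, hy, hl⟩ :=
      exists_hamiltonian_list_of_cycle (hcubic x₁) h₂ h₃ h₂₃ c hc
    exact exists_unshared_paths_of_list hnd hlen hch hx hy hl
  · rintro ⟨P, hP, hshare⟩
    obtain ⟨l, y, hnd, hlen, hch, hx, hy, hl⟩ :=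
      exists_list_of_unshared_paths (by omega) h₂.ne h₃.ne hP hshare
    have hyx : G.Adj y x₁ := by
      obtain rfl | rfl := hy
      · exact h₂.symm
      · exact h₃.symm
    exact exists_hamiltonianCycle_of_list (by omega) hyx hnd hlen hch hx hl

end PaperRCA
end

section
/- Let G be an undirected cubic graph with n vertices, fix a vertex x₁ of G and two distinct neighbors x₂, x₃ of x₁, let η = 2^h be the smallest power of two with η ≥ n, and let G' be the graph of the bounded-degree path construction. Then G has a Hamiltonian cycle if and only if G' admits η + 1 s-t paths sharing at most η − 2 edges. -/
namespace PaperRCA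

/-- Vertices of the bounded-degree path construction (with `η = 2^h`): a copy of the
original vertices; new vertices `v, u, t`; the complete binary tree `T_s` of depth
`h` (vertex `ts d i` is the `i`-th vertex on level `d`; the root `ts 0 0` is `s`,
the leaves are `ts h i`, `i < η`); its disjoint copy `T_w` (with root `tw 0 0 = w`);
the internal vertices `lch i r` of the `(η+i+1)`-chain connecting the `i`-th leaf of
`T_s` to the corresponding leaf of `T_w` (`i` is 0-indexed, so chain lengths are
`η+1, …, η+η`); the internal vertices `svch r` of the `(η+h+(η−n))`-chain connecting
`s` to `v`; and the internal vertices `uwch r` of the `h`-chain connecting `u`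
to `w`. -/
inductive BPCV (n h : ℕ) where
  | orig (x : Fin n) : BPCV n h
  | v : BPCV n h
  | u : BPCV n h
  | t : BPCV n h
  | ts (d : Fin (h + 1)) (i : Fin (2 ^ (d : ℕ))) : BPCV n h
  | tw (d : Fin (h + 1)) (i : Fin (2 ^ (d : ℕ))) : BPCV n h
  | lch (i : Fin (2 ^ h)) (r : Fin (2 ^ h + (i : ℕ))) : BPCV n h
  | svch (r : Fin (2 ^ h + h + (2 ^ h - n) - 1)) : BPCV n h
  | uwch (r : Fin (h - 1)) : BPCV n h

/-- Base edge relation of the bounded-degree path construction (the graph `G'` is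
its symmetric closure, as a simple graph). -/
def BPCRel {n h : ℕ} (G : SimpleGraph (Fin n)) (x₁ x₂ x₃ : Fin n) :
    BPCV n h → BPCV n h → Prop
  | .orig a, .orig b => G.Adj a b
  | .v, .orig a => a = x₁
  | .orig a, .u => a = x₂ ∨ a = x₃
  | .ts d i, .ts d' i' => (d' : ℕ) = (d : ℕ) + 1 ∧
      ((i' : ℕ) = 2 * (i : ℕ) ∨ (i' : ℕ) = 2 * (i : ℕ) + 1)
  | .tw d i, .tw d' i' => (d' : ℕ) = (d : ℕ) + 1 ∧
      ((i' : ℕ) = 2 * (i : ℕ) ∨ (i' : ℕ) = 2 * (i : ℕ) + 1)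
  | .ts d i, .lch j r => (d : ℕ) = h ∧ (i : ℕ) = (j : ℕ) ∧ (r : ℕ) = 0
  | .lch j r, .lch j' r' => (j : ℕ) = (j' : ℕ) ∧ (r' : ℕ) = (r : ℕ) + 1
  | .lch j r, .tw d i => (d : ℕ) = h ∧ (i : ℕ) = (j : ℕ) ∧
      (r : ℕ) + 1 = 2 ^ h + (j : ℕ)
  | .ts d _, .svch r => (d : ℕ) = 0 ∧ (r : ℕ) = 0
  | .svch r, .svch r' => (r' : ℕ) = (r : ℕ) + 1
  | .svch r, .v => (r : ℕ) + 2 = 2 ^ h + h + (2 ^ h - n)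
  | .ts d _, .v => (d : ℕ) = 0 ∧ 2 ^ h + h + (2 ^ h - n) = 1
  | .u, .uwch r => (r : ℕ) = 0
  | .uwch r, .uwch r' => (r' : ℕ) = (r : ℕ) + 1
  | .uwch r, .tw d _ => (d : ℕ) = 0 ∧ (r : ℕ) + 2 = h
  | .u, .tw d _ => (d : ℕ) = 0 ∧ h = 1
  | .tw d _, .t => (d : ℕ) = 0
  | _, _ => False

/-- `p` restricted to `{0, …, L}` is a path of length `L` in `G`. -/
structure IsPathFn {V : Type*} (G : SimpleGraph V) (p : ℕ → V) (L : ℕ) : Prop where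
  adj : ∀ r < L, G.Adj (p r) (p (r + 1))
  inj : ∀ r ≤ L, ∀ r' ≤ L, p r = p r' → r = r'

theorem walkEdges_getElem? {V : Type*} (w : List V) (r : ℕ) (e : Sym2 V) :
    (walkEdges w)[r]? = some e ↔
      ∃ h : r + 1 < w.length, e = s(w[r]'(by omega), w[r + 1]) := by
  unfold walkEdges
  rw [List.getElem?_eq_some_iff]
  simp only [List.length_map, List.length_zip, List.length_tail, List.getElem_map,
    List.getElem_zip, List.getElem_tail]
  constructor
  · rintro ⟨h, rfl⟩
    exact ⟨by omega, rfl⟩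
  · rintro ⟨h, rfl⟩
    exact ⟨by omega, rfl⟩

theorem exists_isPathFn_of_list {V : Type*} {G : SimpleGraph V} {w : List V} {a b : V}
    (hw : IsGWalk G w) (hn : w.Nodup) (ha : w.head? = some a) (hb : w.getLast? = some b) :
    ∃ (p : ℕ → V) (L : ℕ), IsPathFn G p L ∧ p 0 = a ∧ p L = b ∧
      ∀ r e, (walkEdges w)[r]? = some e ↔ r < L ∧ e = s(p r, p (r + 1)) := by
  obtain ⟨hne, hc⟩ := hw
  have hpos : 0 < w.length := List.length_pos_iff.2 hne
  have key : ∀ r (hr : r < w.length), w.getD r a = w[r] := fun r hr => by simp [hr]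
  refine ⟨fun r => w.getD r a, w.length - 1, ⟨?_, ?_⟩, ?_, ?_, ?_⟩
  · intro r hr
    simp only [key r (by omega), key (r + 1) (by omega)]
    exact (List.isChain_iff_getElem.1 hc) r (by omega)
  · intro r hr r' hr' h
    simp only [key r (by omega), key r' (by omega)] at h
    exact (hn.getElem_inj_iff).1 h
  · simp only [key 0 hpos]
    rw [List.head?_eq_getElem?, List.getElem?_eq_getElem hpos] at ha
    exact Option.some.inj ha
  · simp only [key (w.length - 1) (by omega)]
    rw [List.getLast?_eq_getElem?, List.getElem?_eq_getElem (by omega)] at hb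
    exact Option.some.inj hb
  · intro r e
    rw [walkEdges_getElem?]
    constructor
    · rintro ⟨h, rfl⟩
      refine ⟨by omega, ?_⟩
      simp only [key r (by omega), key (r + 1) h]
    · rintro ⟨h, rfl⟩
      refine ⟨by omega, ?_⟩
      simp only [key r (by omega), key (r + 1) (by omega)]

theorem exists_list_of_isPathFn {V : Type*} {G : SimpleGraph V} {p : ℕ → V} {L : ℕ}
    (hp : IsPathFn G p L) :
    ∃ w : List V, IsGWalk G w ∧ w.Nodup ∧ w.head? = some (p 0) ∧ w.getLast? = some (p L) ∧
      ∀ r e, (walkEdges w)[r]? = some e ↔ r < L ∧ e = s(p r, p (r + 1)) := by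
  refine ⟨(List.range (L + 1)).map p, ⟨by simp, ?_⟩, ?_, ?_, ?_, ?_⟩
  · refine List.isChain_iff_getElem.2 fun r hr => ?_
    simp only [List.length_map, List.length_range] at hr
    simpa using hp.adj r (by omega)
  · refine List.Nodup.map_on ?_ List.nodup_range
    intro r hr r' hr' h
    rw [List.mem_range] at hr hr'
    exact hp.inj r (by omega) r' (by omega) h
  · simp [List.head?_range]
  · simp [List.getLast?_range]
  · intro r e
    rw [walkEdges_getElem?]
    simp

theorem exists_walk_of_adj {V : Type*} {G : SimpleGraph V} (y : ℕ → V) (L : ℕ)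
    (hy : ∀ r < L, G.Adj (y r) (y (r + 1))) :
    ∃ w : G.Walk (y 0) (y L), w.length = L ∧ ∀ r ≤ L, w.getVert r = y r := by
  induction L generalizing y with
  | zero => exact ⟨.nil, rfl, fun r hr => by simp [Nat.le_zero.1 hr]⟩
  | succ L ih =>
    obtain ⟨w, hl, hw⟩ := ih (fun r => y (r + 1)) fun r hr => hy (r + 1) (by omega)
    refine ⟨.cons (hy 0 (by omega)) w, by simp [hl], fun r hr => ?_⟩
    cases r with
    | zero => simp
    | succ r => simpa using hw r (by omega)

theorem IsPathFn.exists_isPath {V : Type*} {G : SimpleGraph V} {y : ℕ → V} {L : ℕ}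
    (hy : IsPathFn G y L) : ∃ w : G.Walk (y 0) (y L), w.IsPath ∧ w.length = L := by
  obtain ⟨w, hl, hw⟩ := exists_walk_of_adj y L hy.adj
  refine ⟨w, ?_, hl⟩
  rw [← SimpleGraph.Walk.IsPath.getVert_injOn_iff]
  intro r hr r' hr' h
  simp only [Set.mem_ofPred_eq, hl] at hr hr'
  rw [hw r hr, hw r' hr'] at h
  exact hy.inj r hr r' hr' h

/-- In a cubic graph, a Hamiltonian cycle exists iff there is a Hamiltonian path from `x₁` to one
of two prescribed neighbors of `x₁`. -/
theorem exists_isHamiltonianCycle_iff {n : ℕ} (G : SimpleGraph (Fin n)) [DecidableRel G.Adj]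
    (x₁ x₂ x₃ : Fin n) (hdeg : G.degree x₁ = 3)
    (h₂ : G.Adj x₁ x₂) (h₃ : G.Adj x₁ x₃) (h₂₃ : x₂ ≠ x₃) :
    (∃ (a : Fin n) (c : G.Walk a a), c.IsHamiltonianCycle) ↔
      ∃ y : ℕ → Fin n, IsPathFn G y (n - 1) ∧ y 0 = x₁ ∧ (y (n - 1) = x₂ ∨ y (n - 1) = x₃) := by
  have hn : 4 ≤ n := by
    have := G.degree_lt_card_verts x₁
    rw [hdeg, Fintype.card_fin] at this
    exact this
  constructor
  · rintro ⟨a, c', hc'⟩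
    obtain ⟨c, hc⟩ : ∃ c : G.Walk x₁ x₁, c.IsHamiltonianCycle :=
      ⟨c'.rotate x₁ (hc'.mem_support x₁), hc'.rotate _⟩
    have hlen : c.length = n := by simpa using hc.length_eq
    have hadj : ∀ r < n, G.Adj (c.getVert r) (c.getVert (r + 1)) := fun r hr =>
      c.adj_getVert_succ (by omega)
    have h0 : c.getVert 0 = x₁ := c.getVert_zero
    have hN : c.getVert n = x₁ := c.getVert_of_length_le hlen.le
    have inj1 : ∀ r, 1 ≤ r → r ≤ n → ∀ r', 1 ≤ r' → r' ≤ n →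
        c.getVert r = c.getVert r' → r = r' := fun r h1 h2 r' h1' h2' h =>
      hc.isCycle.getVert_injOn (by simp; omega) (by simp; omega) h
    have inj0 : ∀ r ≤ n - 1, ∀ r' ≤ n - 1,
        c.getVert r = c.getVert r' → r = r' := fun r h2 r' h2' h =>
      hc.isCycle.getVert_injOn' (by simp; omega) (by simp; omega) h
    have hends : c.getVert (n - 1) = x₂ ∨ c.getVert (n - 1) = x₃ ∨
        c.getVert 1 = x₂ ∨ c.getVert 1 = x₃ := by
      by_contra hcon
      push Not at hcon
      obtain ⟨q1, q2, q3, q4⟩ := hcon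
      have q5 : c.getVert 1 ≠ c.getVert (n - 1) := fun h => by
        have := inj1 1 (by omega) (by omega) (n - 1) (by omega) (by omega) h
        omega
      have a1 : G.Adj x₁ (c.getVert 1) := by simpa [h0] using hadj 0 (by omega)
      have a2 : G.Adj x₁ (c.getVert (n - 1)) := by
        have := hadj (n - 1) (by omega)
        rw [Nat.sub_add_cancel (by omega), hN] at this
        exact this.symm
      have hsub : ({c.getVert 1, c.getVert (n - 1), x₂, x₃} : Finset (Fin n)) ⊆
          G.neighborFinset x₁ := by
        intro z hz
        simp only [Finset.mem_insert, Finset.mem_singleton] at hz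
        rw [SimpleGraph.mem_neighborFinset]
        rcases hz with rfl | rfl | rfl | rfl <;> assumption
      have hcard := Finset.card_le_card hsub
      rw [SimpleGraph.card_neighborFinset_eq_degree, hdeg,
        Finset.card_insert_of_notMem (by simp [q5, q3, q4]),
        Finset.card_insert_of_notMem (by simp [q1, q2]),
        Finset.card_insert_of_notMem (by simp [h₂₃]), Finset.card_singleton] at hcard
      omega
    have case1 : IsPathFn G c.getVert (n - 1) := ⟨fun r hr => hadj r (by omega), inj0⟩
    have case2 : IsPathFn G (fun r => c.getVert (n - r)) (n - 1) := by
      refine ⟨fun r hr => ?_, fun r hr r' hr' h => ?_⟩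
      · have := hadj (n - (r + 1)) (by omega)
        rw [show n - (r + 1) + 1 = n - r by omega] at this
        exact this.symm
      · have := inj1 (n - r) (by omega) (by omega) (n - r') (by omega) (by omega) h
        omega
    have e1 : n - (n - 1) = 1 := by omega
    rcases hends with h | h | h | h
    · exact ⟨_, case1, h0, .inl h⟩
    · exact ⟨_, case1, h0, .inr h⟩
    · exact ⟨_, case2, by simpa using hN, .inl (by simpa [e1] using h)⟩
    · exact ⟨_, case2, by simpa using hN, .inr (by simpa [e1] using h)⟩
  · rintro ⟨y, hy, h0, hend⟩
    obtain ⟨w, hw, hl⟩ := hy.exists_isPath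
    have hadj : G.Adj (y (n - 1)) (y 0) := by
      rw [h0]
      rcases hend with h | h <;> rw [h]
      exacts [h₂.symm, h₃.symm]
    refine ⟨_, .cons hadj w, ?_⟩
    rw [SimpleGraph.Walk.isHamiltonianCycle_iff_isCycle_and_length_eq,
      SimpleGraph.Walk.isCycle_iff_isPath_tail_and_le_length]
    refine ⟨⟨by simpa using hw, ?_⟩, ?_⟩ <;> simp [hl] <;> omega

/-- The graph `G'` of the bounded-degree path construction. -/
abbrev bpcGraph {n : ℕ} (h : ℕ) (G : SimpleGraph (Fin n)) (x₁ x₂ x₃ : Fin n) :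
    SimpleGraph (BPCV n h) :=
  SimpleGraph.fromRel (BPCRel G x₁ x₂ x₃)

/-- The root `s` of `T_s`. -/
abbrev BPCV.s (n h : ℕ) : BPCV n h := .ts ⟨0, Nat.succ_pos h⟩ ⟨0, Nat.two_pow_pos _⟩

/-- The root `w` of `T_w`. -/
abbrev BPCV.w (n h : ℕ) : BPCV n h := .tw ⟨0, Nat.succ_pos h⟩ ⟨0, Nat.two_pow_pos _⟩

/-- `LeafPos i r x` says that `x` is the `r`-th vertex of the path that descends `T_s` to the
`i`-th leaf, follows the `i`-th chain and ascends `T_w` to `w` and then `t`. -/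
def LeafPos {n h : ℕ} (i r : ℕ) : BPCV n h → Prop
  | .ts d k => (d : ℕ) = r ∧ (k : ℕ) = i / 2 ^ (h - (d : ℕ))
  | .lch j q => (j : ℕ) = i ∧ r = h + 1 + (q : ℕ)
  | .tw d k => r + (d : ℕ) = 2 * h + 2 ^ h + i + 1 ∧ (k : ℕ) = i / 2 ^ (h - (d : ℕ))
  | .t => r = 2 * h + 2 ^ h + i + 2
  | _ => False

/-- `GraphPos y m r x` says that `x` is the `r`-th vertex of the path that follows the chain from
`s` to `v`, visits the original vertices `y 0, …, y (m - 1)`, and then follows the chain from `u`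
to `w` and finishes in `t`. -/
def GraphPos {n h : ℕ} (y : ℕ → Fin n) (m r : ℕ) : BPCV n h → Prop
  | .ts d _ => (d : ℕ) = 0 ∧ r = 0
  | .svch q => r = (q : ℕ) + 1
  | .v => r = 2 ^ h + h + (2 ^ h - n)
  | .orig a => ∃ q < m, y q = a ∧ r = 2 ^ h + h + (2 ^ h - n) + 1 + q
  | .u => r = 2 ^ h + h + (2 ^ h - n) + 1 + m
  | .uwch q => r = 2 ^ h + h + (2 ^ h - n) + 2 + m + (q : ℕ)
  | .tw d _ => (d : ℕ) = 0 ∧ r = 2 ^ h + h + (2 ^ h - n) + 1 + m + h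
  | .t => r = 2 ^ h + h + (2 ^ h - n) + 2 + m + h
  | .lch _ _ => False

theorem div_two_pow_div_two {h d : ℕ} (i : ℕ) (hd : d < h) :
    i / 2 ^ (h - (d + 1)) / 2 = i / 2 ^ (h - d) := by
  rw [Nat.div_div_eq_div_mul, ← pow_succ]
  congr 2
  omega

theorem div_two_pow_lt {h i : ℕ} (hi : i < 2 ^ h) (d : ℕ) (hd : d ≤ h) :
    i / 2 ^ (h - d) < 2 ^ d := by
  rw [Nat.div_lt_iff_lt_mul (by positivity), ← pow_add]
  rwa [Nat.add_sub_cancel' hd]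

theorem LeafPos.exists {n h i : ℕ} (hi : i < 2 ^ h) {r : ℕ} (hr : r ≤ 2 * h + 2 ^ h + i + 2) :
    ∃ x : BPCV n h, LeafPos i r x := by
  by_cases h1 : r ≤ h
  · exact ⟨.ts ⟨r, by omega⟩ ⟨i / 2 ^ (h - r), div_two_pow_lt hi r h1⟩, rfl, rfl⟩
  by_cases h2 : r ≤ h + 2 ^ h + i
  · exact ⟨.lch ⟨i, hi⟩ ⟨r - (h + 1), by simp only; omega⟩, rfl, by simp only; omega⟩
  by_cases h3 : r ≤ 2 * h + 2 ^ h + i + 1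
  · exact ⟨.tw ⟨2 * h + 2 ^ h + i + 1 - r, by omega⟩
      ⟨i / 2 ^ (h - (2 * h + 2 ^ h + i + 1 - r)), div_two_pow_lt hi _ (by omega)⟩,
      by simp only; omega, rfl⟩
  · exact ⟨.t, by simp only [LeafPos]; omega⟩

theorem LeafPos.index_unique {n h i r r' : ℕ} {x : BPCV n h}
    (hx : LeafPos i r x) (hx' : LeafPos i r' x) : r = r' := by
  cases x <;> simp only [LeafPos] at hx hx' <;> omega

theorem BPCV.ts_ext {n h : ℕ} {d d' : Fin (h + 1)} {k : Fin (2 ^ (d : ℕ))}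
    {k' : Fin (2 ^ (d' : ℕ))} (hd : (d : ℕ) = d') (hk : (k : ℕ) = k') :
    (BPCV.ts d k : BPCV n h) = .ts d' k' := by
  obtain rfl := Fin.ext hd
  obtain rfl := Fin.ext hk
  rfl

theorem BPCV.tw_ext {n h : ℕ} {d d' : Fin (h + 1)} {k : Fin (2 ^ (d : ℕ))}
    {k' : Fin (2 ^ (d' : ℕ))} (hd : (d : ℕ) = d') (hk : (k : ℕ) = k') :
    (BPCV.tw d k : BPCV n h) = .tw d' k' := by
  obtain rfl := Fin.ext hd
  obtain rfl := Fin.ext hk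
  rfl

theorem BPCV.lch_ext {n h : ℕ} {j j' : Fin (2 ^ h)} {q : Fin (2 ^ h + (j : ℕ))}
    {q' : Fin (2 ^ h + (j' : ℕ))} (hj : (j : ℕ) = j') (hq : (q : ℕ) = q') :
    (BPCV.lch j q : BPCV n h) = .lch j' q' := by
  obtain rfl := Fin.ext hj
  obtain rfl := Fin.ext hq
  rfl

theorem LeafPos.unique {n h i r : ℕ} {x x' : BPCV n h}
    (hx : LeafPos i r x) (hx' : LeafPos i r x') : x = x' := by
  have hpow := Nat.two_pow_pos h
  rcases x with a | _ | _ | _ | ⟨d, k⟩ | ⟨d, k⟩ | ⟨j, q⟩ | q | q <;>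
  rcases x' with a' | _ | _ | _ | ⟨d', k'⟩ | ⟨d', k'⟩ | ⟨j', q'⟩ | q' | q' <;>
  simp only [LeafPos] at hx hx' <;> first | rfl | omega | skip
  · have hd : (d : ℕ) = d' := by omega
    exact BPCV.ts_ext hd (by simp only [hx.2, hx'.2, hd])
  · have hd : (d : ℕ) = d' := by omega
    exact BPCV.tw_ext hd (by simp only [hx.2, hx'.2, hd])
  · exact BPCV.lch_ext (by omega) (by omega)

theorem LeafPos.adj {n h : ℕ} {G : SimpleGraph (Fin n)} {x₁ x₂ x₃ : Fin n} {i r : ℕ}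
    {x x' : BPCV n h} (hx : LeafPos i r x) (hx' : LeafPos i (r + 1) x') :
    (bpcGraph h G x₁ x₂ x₃).Adj x x' := by
  refine (SimpleGraph.fromRel_adj _ _ _).2 ⟨?_, ?_⟩
  · rintro rfl
    have := hx.index_unique hx'
    omega
  have hpow := Nat.two_pow_pos h
  rcases x with a | _ | _ | _ | ⟨d, k⟩ | ⟨d, k⟩ | ⟨j, q⟩ | q | q <;>
  rcases x' with a' | _ | _ | _ | ⟨d', k'⟩ | ⟨d', k'⟩ | ⟨j', q'⟩ | q' | q' <;>
  simp only [LeafPos, BPCRel] at hx hx' ⊢ <;> first | omega | skip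
  · have hd : (d' : ℕ) = d + 1 := by omega
    have := div_two_pow_div_two (h := h) (d := d) i (by omega)
    simp only [hd] at hx'
    omega
  · have hd : (d : ℕ) = h := by omega
    simp only [hd, Nat.sub_self, pow_zero, Nat.div_one] at hx
    omega
  · have hd : (d : ℕ) = d' + 1 := by omega
    have := div_two_pow_div_two (h := h) (d := d') i (by omega)
    simp only [hd] at hx
    omega
  · have hd : (d' : ℕ) = h := by omega
    simp only [hd, Nat.sub_self, pow_zero, Nat.div_one] at hx'
    omega

theorem GraphPos.exists {n h m : ℕ} (y : ℕ → Fin n) (hh : 2 ≤ h) {r : ℕ}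
    (hr : r ≤ 2 ^ h + h + (2 ^ h - n) + 2 + m + h) :
    ∃ x : BPCV n h, GraphPos y m r x := by
  have hpow := Nat.two_pow_pos h
  by_cases h0 : r = 0
  · exact ⟨BPCV.s n h, rfl, h0⟩
  by_cases h1 : r < 2 ^ h + h + (2 ^ h - n)
  · exact ⟨.svch ⟨r - 1, by omega⟩, by simp only [GraphPos]; omega⟩
  by_cases h2 : r = 2 ^ h + h + (2 ^ h - n)
  · exact ⟨.v, h2⟩
  by_cases h3 : r < 2 ^ h + h + (2 ^ h - n) + 1 + m
  · exact ⟨.orig (y (r - (2 ^ h + h + (2 ^ h - n) + 1))),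
      r - (2 ^ h + h + (2 ^ h - n) + 1), by omega, rfl, by omega⟩
  by_cases h4 : r = 2 ^ h + h + (2 ^ h - n) + 1 + m
  · exact ⟨.u, h4⟩
  by_cases h5 : r < 2 ^ h + h + (2 ^ h - n) + 1 + m + h
  · exact ⟨.uwch ⟨r - (2 ^ h + h + (2 ^ h - n) + 2 + m), by omega⟩,
      by simp only [GraphPos]; omega⟩
  by_cases h6 : r = 2 ^ h + h + (2 ^ h - n) + 1 + m + h
  · exact ⟨BPCV.w n h, rfl, h6⟩
  · exact ⟨.t, by simp only [GraphPos]; omega⟩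

theorem GraphPos.index_unique {n h m r r' : ℕ} {y : ℕ → Fin n}
    (hy : ∀ q < m, ∀ q' < m, y q = y q' → q = q') {x : BPCV n h}
    (hx : GraphPos y m r x) (hx' : GraphPos y m r' x) : r = r' := by
  cases x <;> simp only [GraphPos] at hx hx' <;> try omega
  obtain ⟨q, hq, rfl, rfl⟩ := hx
  obtain ⟨q', hq', he, rfl⟩ := hx'
  rw [hy q hq q' hq' he.symm]

theorem GraphPos.unique {n h m m' r : ℕ} (hh : 2 ≤ h) {y y' : ℕ → Fin n} {x x' : BPCV n h}
    (hr : r ≤ 2 ^ h + h + (2 ^ h - n) ∨ y = y' ∧ m = m')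
    (hx : GraphPos y m r x) (hx' : GraphPos y' m' r x') : x = x' := by
  have hpow := Nat.two_pow_pos h
  rcases x with a | _ | _ | _ | ⟨d, k⟩ | ⟨d, k⟩ | ⟨j, q⟩ | q | q <;>
  rcases x' with a' | _ | _ | _ | ⟨d', k'⟩ | ⟨d', k'⟩ | ⟨j', q'⟩ | q' | q' <;>
  simp only [GraphPos] at hx hx' <;> first | rfl | omega | skip
  · obtain ⟨q, hq, rfl, rfl⟩ := hx
    obtain ⟨q', hq', rfl, he⟩ := hx'
    obtain rfl : q' = q := by omega
    rcases hr with hr | ⟨rfl, -⟩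
    · omega
    · rfl
  any_goals grind
  · have hk := k.2
    have hk' := k'.2
    simp only [hx.1, pow_zero] at hk
    simp only [hx'.1, pow_zero] at hk'
    exact BPCV.ts_ext (by omega) (by omega)
  · have hk := k.2
    have hk' := k'.2
    simp only [hx.1, pow_zero] at hk
    simp only [hx'.1, pow_zero] at hk'
    exact BPCV.tw_ext (by omega) (by omega)

theorem GraphPos.adj {n h m : ℕ} {G : SimpleGraph (Fin n)} {x₁ x₂ x₃ : Fin n} {r : ℕ}
    (hh : 2 ≤ h) {y : ℕ → Fin n} (hy : IsPathFn G y m) (hy0 : y 0 = x₁)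
    (hym : y m = x₂ ∨ y m = x₃) {x x' : BPCV n h}
    (hx : GraphPos y (m + 1) r x) (hx' : GraphPos y (m + 1) (r + 1) x') :
    (bpcGraph h G x₁ x₂ x₃).Adj x x' := by
  have hpow := Nat.two_pow_pos h
  refine (SimpleGraph.fromRel_adj _ _ _).2 ⟨?_, ?_⟩
  · rintro rfl
    have := hx.index_unique
      (fun q hq q' hq' => hy.inj q (Nat.lt_succ_iff.1 hq) q' (Nat.lt_succ_iff.1 hq')) hx'
    omega
  rcases x with a | _ | _ | _ | ⟨d, k⟩ | ⟨d, k⟩ | ⟨j, q⟩ | q | q <;>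
  rcases x' with a' | _ | _ | _ | ⟨d', k'⟩ | ⟨d', k'⟩ | ⟨j', q'⟩ | q' | q' <;>
  simp only [GraphPos, BPCRel] at hx hx' ⊢ <;> first | omega | skip
  · obtain ⟨q, hq, rfl, rfl⟩ := hx
    obtain ⟨q', hq', rfl, he⟩ := hx'
    obtain rfl : q' = q + 1 := by omega
    exact .inl (hy.adj q (by omega))
  all_goals grind

theorem exists_isPathFn_leafPos {n h i : ℕ} (G : SimpleGraph (Fin n)) (x₁ x₂ x₃ : Fin n)
    (hi : i < 2 ^ h) :
    ∃ p : ℕ → BPCV n h, IsPathFn (bpcGraph h G x₁ x₂ x₃) p (2 * h + 2 ^ h + i + 2) ∧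
      p 0 = BPCV.s n h ∧ p (2 * h + 2 ^ h + i + 2) = .t ∧
      ∀ r ≤ 2 * h + 2 ^ h + i + 2, LeafPos i r (p r) := by
  have : Nonempty (BPCV n h) := ⟨.t⟩
  choose! p hp using fun r (hr : r ≤ 2 * h + 2 ^ h + i + 2) => LeafPos.exists (n := n) hi hr
  refine ⟨p, ⟨fun r hr => (hp r hr.le).adj (hp (r + 1) hr), fun r hr r' hr' he => ?_⟩, ?_, ?_, hp⟩
  · have := hp r' hr'
    rw [← he] at this
    exact (hp r hr).index_unique this
  · exact (hp 0 (by omega)).unique ⟨rfl, by simp only [Nat.sub_zero, Nat.div_eq_of_lt hi]⟩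
  · exact (hp _ le_rfl).unique rfl

theorem exists_isPathFn_graphPos {n h m : ℕ} {G : SimpleGraph (Fin n)} {x₁ x₂ x₃ : Fin n}
    (hh : 2 ≤ h) {y : ℕ → Fin n} (hy : IsPathFn G y m) (hy0 : y 0 = x₁)
    (hym : y m = x₂ ∨ y m = x₃) :
    ∃ p : ℕ → BPCV n h,
      IsPathFn (bpcGraph h G x₁ x₂ x₃) p (2 ^ h + h + (2 ^ h - n) + 2 + (m + 1) + h) ∧
      p 0 = BPCV.s n h ∧ p (2 ^ h + h + (2 ^ h - n) + 2 + (m + 1) + h) = .t ∧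
      ∀ r ≤ 2 ^ h + h + (2 ^ h - n) + 2 + (m + 1) + h, GraphPos y (m + 1) r (p r) := by
  have : Nonempty (BPCV n h) := ⟨.t⟩
  choose! p hp using fun r (hr : r ≤ 2 ^ h + h + (2 ^ h - n) + 2 + (m + 1) + h) =>
    GraphPos.exists (n := n) y hh hr
  refine ⟨p, ⟨fun r hr => (hp r hr.le).adj hh hy hy0 hym (hp (r + 1) hr),
    fun r hr r' hr' he => ?_⟩, ?_, ?_, hp⟩
  · have := hp r' hr'
    rw [← he] at this
    exact (hp r hr).index_unique
      (fun q hq q' hq' => hy.inj q (Nat.lt_succ_iff.1 hq) q' (Nat.lt_succ_iff.1 hq')) this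
  · exact GraphPos.unique hh (.inr ⟨rfl, rfl⟩) (hp 0 (Nat.zero_le _)) ⟨rfl, rfl⟩
  · exact GraphPos.unique hh (.inr ⟨rfl, rfl⟩) (hp _ le_rfl) rfl

/-- The edges of `T_s` that are not incident to a leaf: the pair `⟨d, k⟩` stands for the edge from
the `k`-th vertex of level `d + 1` to its parent. -/
def treeEdge (n h : ℕ) (σ : Σ d : Fin (h - 1), Fin (2 ^ ((d : ℕ) + 1))) : Sym2 (BPCV n h) :=
  s(.ts ⟨σ.1, by omega⟩
      ⟨(σ.2 : ℕ) / 2, Nat.div_lt_of_lt_mul (lt_of_lt_of_eq σ.2.2 (pow_succ' 2 _))⟩,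
    .ts ⟨(σ.1 : ℕ) + 1, by omega⟩ σ.2)

theorem card_treeEdge_index (h : ℕ) (hh : 1 ≤ h) :
    Fintype.card (Σ d : Fin (h - 1), Fin (2 ^ ((d : ℕ) + 1))) = 2 ^ h - 2 := by
  simp only [Fintype.card_sigma, Fintype.card_fin]
  rw [Fin.sum_univ_eq_sum_range (fun d => 2 ^ (d + 1))]
  obtain ⟨k, rfl⟩ := Nat.exists_eq_add_of_le' hh
  simp only [pow_succ, ← Finset.sum_mul, Nat.add_sub_cancel, Nat.geomSum_eq (le_refl 2)]
  omega

theorem treeEdge_injective (n h : ℕ) : Function.Injective (treeEdge n h) := by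
  rintro ⟨d, k⟩ ⟨d', k'⟩ he
  simp only [treeEdge, Sym2.eq_iff, BPCV.ts.injEq, Fin.mk.injEq] at he
  have hd : d = d' := Fin.ext (by omega)
  subst hd
  have hk : k = k' := by
    rcases he with he | he
    · exact eq_of_heq he.2.2
    · omega
  rw [hk]

theorem LeafPos.mem_range_treeEdge {n h i j r : ℕ} (hij : i ≠ j) {x x' z z' : BPCV n h}
    (hx : LeafPos i r x) (hx' : LeafPos i (r + 1) x')
    (hz : LeafPos j r z) (hz' : LeafPos j (r + 1) z') (he : s(x, x') = s(z, z')) :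
    s(x, x') ∈ Set.range (treeEdge n h) := by
  have hpow := Nat.two_pow_pos h
  rcases Sym2.eq_iff.1 he with ⟨rfl, rfl⟩ | ⟨rfl, rfl⟩ <;>
  rcases x with a | _ | _ | _ | ⟨d, k⟩ | ⟨d, k⟩ | ⟨j, q⟩ | q | q <;>
  rcases x' with a' | _ | _ | _ | ⟨d', k'⟩ | ⟨d', k'⟩ | ⟨j', q'⟩ | q' | q' <;>
  simp only [LeafPos] at hx hx' hz hz' <;> first | omega | skip
  have hd' : (d' : ℕ) < h := by
    by_contra hcon
    have hd : (d' : ℕ) = h := by omega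
    simp only [hd, Nat.sub_self, pow_zero, Nat.div_one] at hx' hz'
    omega
  have hd : (d' : ℕ) = d + 1 := by omega
  have hk' := k'.2
  have hdiv := div_two_pow_div_two (h := h) (d := d) i (by omega)
  simp only [hd] at hx' hk'
  refine ⟨⟨⟨d, by omega⟩, ⟨k', hk'⟩⟩, ?_⟩
  exact congrArg₂ (fun a b => s(a, b)) (BPCV.ts_ext rfl (by simp only; omega))
    (BPCV.ts_ext hd.symm rfl)

theorem GraphPos.ne_leafPos {n h i r : ℕ} (hn : n ≤ 2 ^ h) (hi : i < 2 ^ h)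
    {y : ℕ → Fin n} {x x' z z' : BPCV n h}
    (hx : GraphPos y n r x) (hx' : GraphPos y n (r + 1) x')
    (hz : LeafPos i r z) (hz' : LeafPos i (r + 1) z') : s(x, x') ≠ s(z, z') := by
  intro he
  rcases Sym2.eq_iff.1 he with ⟨rfl, rfl⟩ | ⟨rfl, rfl⟩ <;>
  rcases x with a | _ | _ | _ | ⟨d, k⟩ | ⟨d, k⟩ | ⟨j, q⟩ | q | q <;>
  rcases x' with a' | _ | _ | _ | ⟨d', k'⟩ | ⟨d', k'⟩ | ⟨j', q'⟩ | q' | q' <;>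
  simp only [LeafPos, GraphPos] at hx hx' hz hz' <;> omega

/-- The edges occurring at the same position in two distinct members of a family of walks given by
their vertex functions and lengths. -/
def sharedEdges {V : Type*} {N : ℕ} (p : Fin N → ℕ → V) (L : Fin N → ℕ) : Set (Sym2 V) :=
  {e | ∃ i j, i ≠ j ∧ ∃ r, (r < L i ∧ e = s(p i r, p i (r + 1))) ∧
    (r < L j ∧ e = s(p j r, p j (r + 1)))}

theorem exists_paths_iff {V : Type*} {G : SimpleGraph V} {N K : ℕ} {a b : V} :
    (∃ P : Fin N → List V,
      (∀ i, IsGWalk G (P i) ∧ (P i).Nodup ∧ (P i).head? = some a ∧ (P i).getLast? = some b) ∧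
      {e : Sym2 V | SharedEdge P e}.ncard ≤ K) ↔
    ∃ (p : Fin N → ℕ → V) (L : Fin N → ℕ),
      (∀ i, IsPathFn G (p i) (L i) ∧ p i 0 = a ∧ p i (L i) = b) ∧
      (sharedEdges p L).ncard ≤ K := by
  constructor
  · rintro ⟨P, hP, hK⟩
    choose p L hp ha hb he using fun i =>
      exists_isPathFn_of_list (hP i).1 (hP i).2.1 (hP i).2.2.1 (hP i).2.2.2
    refine ⟨p, L, fun i => ⟨hp i, ha i, hb i⟩, ?_⟩
    simpa only [SharedEdge, sharedEdges, he] using hK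
  · rintro ⟨p, L, hp, hK⟩
    choose P h1 h2 h3 h4 he using fun i => exists_list_of_isPathFn (hp i).1
    refine ⟨P, fun i => ⟨h1 i, h2 i, ?_, ?_⟩, ?_⟩
    · rw [h3 i, (hp i).2.1]
    · rw [h4 i, (hp i).2.2]
    · simpa only [SharedEdge, sharedEdges, he] using hK

theorem finite_sharedEdges {V : Type*} {N : ℕ} (p : Fin N → ℕ → V) (L : Fin N → ℕ) :
    (sharedEdges p L).Finite := by
  refine (Set.finite_iUnion fun i : Fin N =>
    (Set.finite_Iio (L i)).image fun r => s(p i r, p i (r + 1))).subset ?_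
  rintro e ⟨i, j, -, r, ⟨hr, rfl⟩, -⟩
  exact Set.mem_iUnion.2 ⟨i, r, hr, rfl⟩

theorem IsPathFn.edge_inj {V : Type*} {G : SimpleGraph V} {p : ℕ → V} {L : ℕ}
    (hp : IsPathFn G p L) {r r' : ℕ} (hr : r < L) (hr' : r' < L)
    (he : s(p r, p (r + 1)) = s(p r', p (r' + 1))) : r = r' := by
  rcases Sym2.eq_iff.1 he with ⟨h1, -⟩ | ⟨h1, h2⟩
  · exact hp.inj _ hr.le _ hr'.le h1
  · have := hp.inj _ hr.le _ hr' h1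
    have := hp.inj _ hr _ hr'.le h2
    omega

/-- Two paths with a common initial segment of length `M` share at least `M` edges. -/
theorem le_ncard_sharedEdges {V : Type*} {G : SimpleGraph V} {N : ℕ} {p : Fin N → ℕ → V}
    {L : Fin N → ℕ} {i j : Fin N} (hij : i ≠ j) (hp : IsPathFn G (p i) (L i)) {M : ℕ}
    (hi : M ≤ L i) (hj : M ≤ L j) (heq : ∀ r ≤ M, p i r = p j r) :
    M ≤ (sharedEdges p L).ncard := by
  have hsub : (fun r => s(p i r, p i (r + 1))) '' Set.Iio M ⊆ sharedEdges p L := by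
    rintro _ ⟨r, hr, rfl⟩
    rw [Set.mem_Iio] at hr
    exact ⟨i, j, hij, r, ⟨by omega, rfl⟩, by omega, by
      simp only [heq r (by omega), heq (r + 1) hr]⟩
  have hcard : ((fun r => s(p i r, p i (r + 1))) '' Set.Iio M).ncard = M := by
    rw [Set.InjOn.ncard_image]
    · rw [← Finset.coe_Iio, Set.ncard_coe_finset, Nat.card_Iio]
    · intro r hr r' hr' he
      rw [Set.mem_Iio] at hr hr'
      exact hp.edge_inj (by omega) (by omega) he
  rw [← hcard]
  exact Set.ncard_le_ncard hsub (finite_sharedEdges p L)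

theorem exists_paths_of_isPathFn {n h : ℕ} {G : SimpleGraph (Fin n)} {x₁ x₂ x₃ : Fin n}
    (hh : 2 ≤ h) (hn : n ≤ 2 ^ h) (hn' : 1 ≤ n) {y : ℕ → Fin n} (hy : IsPathFn G y (n - 1))
    (hy0 : y 0 = x₁) (hyn : y (n - 1) = x₂ ∨ y (n - 1) = x₃) :
    ∃ (p : Fin (2 ^ h + 1) → ℕ → BPCV n h) (L : Fin (2 ^ h + 1) → ℕ),
      (∀ i, IsPathFn (bpcGraph h G x₁ x₂ x₃) (p i) (L i) ∧ p i 0 = BPCV.s n h ∧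
        p i (L i) = .t) ∧ (sharedEdges p L).ncard ≤ 2 ^ h - 2 := by
  have key : ∀ i : Fin (2 ^ h + 1), ∃ (p : ℕ → BPCV n h) (L : ℕ),
      (IsPathFn (bpcGraph h G x₁ x₂ x₃) p L ∧ p 0 = BPCV.s n h ∧ p L = .t) ∧
      (((i : ℕ) < 2 ^ h ∧ ∀ r ≤ L, LeafPos i r (p r)) ∨
        ((i : ℕ) = 2 ^ h ∧ ∀ r ≤ L, GraphPos y n r (p r))) := by
    intro i
    by_cases hi : (i : ℕ) < 2 ^ h
    · obtain ⟨p, h1, h2, h3, h4⟩ := exists_isPathFn_leafPos G x₁ x₂ x₃ hi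
      exact ⟨p, _, ⟨h1, h2, h3⟩, .inl ⟨hi, h4⟩⟩
    · obtain ⟨p, h1, h2, h3, h4⟩ := exists_isPathFn_graphPos hh hy hy0 hyn
      rw [Nat.sub_add_cancel hn'] at *
      exact ⟨p, _, ⟨h1, h2, h3⟩, .inr ⟨by omega, h4⟩⟩
  choose p L hp hpos using key
  refine ⟨p, L, hp, ?_⟩
  have hsub : sharedEdges p L ⊆ Set.range (treeEdge n h) := by
    rintro e ⟨i, j, hij, r, ⟨hri, rfl⟩, hrj, he⟩
    have hij' : (i : ℕ) ≠ j := fun h => hij (Fin.ext h)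
    rcases hpos i with ⟨hi, hi'⟩ | ⟨hi, hi'⟩ <;> rcases hpos j with ⟨hj, hj'⟩ | ⟨hj, hj'⟩
    · exact (hi' r hri.le).mem_range_treeEdge hij' (hi' (r + 1) hri) (hj' r hrj.le)
        (hj' (r + 1) hrj) he
    · exact absurd he.symm ((hj' r hrj.le).ne_leafPos hn hi (hj' (r + 1) hrj) (hi' r hri.le)
        (hi' (r + 1) hri))
    · exact absurd he ((hi' r hri.le).ne_leafPos hn hj (hi' (r + 1) hri) (hj' r hrj.le)
        (hj' (r + 1) hrj))
    · omega
  calc (sharedEdges p L).ncard ≤ (Set.range (treeEdge n h)).ncard :=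
        Set.ncard_le_ncard hsub (Set.finite_range _)
    _ = 2 ^ h - 2 := by
        rw [← Set.image_univ, Set.ncard_image_of_injective _ (treeEdge_injective n h),
          Set.ncard_univ, Nat.card_eq_fintype_card, card_treeEdge_index h (by omega)]

/-- A path ends in `S` if it is in `S` at some time by which it has already visited all outer
boundary vertices of `S`. -/
theorem IsPathFn.mem_of_boundary {V : Type*} {G : SimpleGraph V} {p : ℕ → V} {L r₀ : ℕ}
    (hp : IsPathFn G p L) (S : V → Prop) (hr₀ : r₀ ≤ L) (h0 : S (p r₀))
    (hS : ∀ x x', S x → G.Adj x x' → ¬ S x' → ∃ r' < r₀, p r' = x') : S (p L) := by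
  refine Nat.le_induction (P := fun r _ => r ≤ L → S (p r)) (fun _ => h0) ?_ L hr₀ le_rfl
  intro r hr ih hrL
  by_contra hcon
  obtain ⟨r', hr', he⟩ := hS _ _ (ih (by omega)) (hp.adj r hrL) hcon
  have := hp.inj r' (by omega) (r + 1) hrL he
  omega

theorem IsPathFn.not_visited {V : Type*} {G : SimpleGraph V} {p : ℕ → V} {L r : ℕ}
    (hp : IsPathFn G p L) (hr : r < L) {R : ℕ → V → Prop} (hR : ∀ r' ≤ r, R r' (p r'))
    (huniq : ∀ r' ≤ r, ∀ x x', R r' x → R r' x' → x = x') :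
    ∀ r' ≤ r, ¬ R r' (p (r + 1)) := by
  intro r' hr' hcon
  have := hp.inj r' (by omega) (r + 1) hr (huniq r' hr' _ _ (hR r' hr') hcon)
  omega

theorem IsPathFn.not_mem_of_boundary_visited {V : Type*} {G : SimpleGraph V} {p : ℕ → V} {L r : ℕ}
    (hp : IsPathFn G p L) (hr : r < L) {R : ℕ → V → Prop} (hR : ∀ r' ≤ r, R r' (p r'))
    (huniq : ∀ r' ≤ r, ∀ x x', R r' x → R r' x' → x = x') (S : V → Prop) (hL : ¬ S (p L))
    (hS : ∀ x x', S x → G.Adj x x' → ¬ S x' → ∃ r' ≤ r, R r' x') : ¬ S (p (r + 1)) := by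
  refine fun h0 => hL (hp.mem_of_boundary S hr h0 fun x x' hx hadj hx' => ?_)
  obtain ⟨r', hr', h⟩ := hS x x' hx hadj hx'
  exact ⟨r', Nat.lt_succ_iff.2 hr', huniq r' hr' _ _ (hR r' hr') h⟩

/-- The vertices hanging below the `k`-th vertices of level `d` of the two trees. -/
def Below {n h : ℕ} (d k : ℕ) : BPCV n h → Prop
  | .ts d' k' => d ≤ (d' : ℕ) ∧ (k' : ℕ) / 2 ^ ((d' : ℕ) - d) = k
  | .tw d' k' => d ≤ (d' : ℕ) ∧ (k' : ℕ) / 2 ^ ((d' : ℕ) - d) = k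
  | .lch j _ => (j : ℕ) / 2 ^ (h - d) = k
  | _ => False

/-- `x` is the `k`-th vertex of level `d` of one of the two trees. -/
def TreeVertex {n h : ℕ} (d k : ℕ) : BPCV n h → Prop
  | .ts d' k' => (d' : ℕ) = d ∧ (k' : ℕ) = k
  | .tw d' k' => (d' : ℕ) = d ∧ (k' : ℕ) = k
  | _ => False

theorem div_two_pow_sub_succ {d e : ℕ} (k : ℕ) (hd : d ≤ e) :
    k / 2 / 2 ^ (e - d) = k / 2 ^ (e + 1 - d) := by
  rw [Nat.div_div_eq_div_mul, ← pow_succ', Nat.succ_sub hd]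

theorem Below.boundary {n h d k : ℕ} {G : SimpleGraph (Fin n)} {x₁ x₂ x₃ : Fin n}
    (hdh : d + 1 ≤ h) {x x' : BPCV n h} (hx : Below (d + 1) k x)
    (hadj : (bpcGraph h G x₁ x₂ x₃).Adj x x') (hx' : ¬ Below (d + 1) k x') :
    TreeVertex d (k / 2) x' := by
  have hadj := ((SimpleGraph.fromRel_adj _ _ _).1 hadj).2
  have key : ∀ e e' l l' : ℕ, e' = e + 1 → (l' = 2 * l ∨ l' = 2 * l + 1) →
      (d + 1 ≤ e ∧ l / 2 ^ (e - (d + 1)) = k → d + 1 ≤ e' ∧ l' / 2 ^ (e' - (d + 1)) = k) ∧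
      (d + 1 ≤ e' ∧ l' / 2 ^ (e' - (d + 1)) = k →
        ¬ (d + 1 ≤ e ∧ l / 2 ^ (e - (d + 1)) = k) → e = d ∧ l = k / 2) := by
    rintro e _ l l' rfl hl
    obtain rfl : l = l' / 2 := by omega
    by_cases he : d + 1 ≤ e
    · rw [div_two_pow_sub_succ _ he]
      grind
    · refine ⟨fun h => absurd h.1 he, fun h _ => ?_⟩
      obtain rfl : e = d := by omega
      refine ⟨rfl, ?_⟩
      rw [← h.2, Nat.sub_self, pow_zero, Nat.div_one]
  rcases x with a | _ | _ | _ | ⟨e, l⟩ | ⟨e, l⟩ | ⟨j, q⟩ | q | q <;>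
  rcases x' with a' | _ | _ | _ | ⟨e', l'⟩ | ⟨e', l'⟩ | ⟨j', q'⟩ | q' | q' <;>
  simp only [Below, TreeVertex, BPCRel, or_false, false_or] at hx hx' hadj ⊢ <;>
  first | omega | skip
  · rcases hadj with hadj | hadj
    · exact absurd ((key _ _ _ _ hadj.1 hadj.2).1 hx) hx'
    · exact (key _ _ _ _ hadj.1 hadj.2).2 hx hx'
  · have he : (e : ℕ) = h := by omega
    simp only [he] at hx
    grind
  · rcases hadj with hadj | hadj
    · exact absurd ((key _ _ _ _ hadj.1 hadj.2).1 hx) hx'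
    · exact (key _ _ _ _ hadj.1 hadj.2).2 hx hx'
  all_goals grind

/-- The vertices of the copy of `G`, of the two chains attached to it, and `u`, `v`. -/
def Middle {n h : ℕ} : BPCV n h → Prop
  | .ts _ _ => False
  | .tw _ _ => False
  | .lch _ _ => False
  | .t => False
  | _ => True

theorem Middle.boundary {n h : ℕ} {G : SimpleGraph (Fin n)} {x₁ x₂ x₃ : Fin n}
    {x x' : BPCV n h} (hx : Middle x) (hadj : (bpcGraph h G x₁ x₂ x₃).Adj x x')
    (hx' : ¬ Middle x') : TreeVertex 0 0 x' := by
  have hadj := ((SimpleGraph.fromRel_adj _ _ _).1 hadj).2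
  rcases x with a | _ | _ | _ | ⟨e, l⟩ | ⟨e, l⟩ | ⟨j, q⟩ | q | q <;>
  rcases x' with a' | _ | _ | _ | ⟨e', l'⟩ | ⟨e', l'⟩ | ⟨j', q'⟩ | q' | q' <;>
  simp only [Middle, not_true, TreeVertex, BPCRel, or_false, false_or] at hx hx' hadj ⊢ <;>
  exact ⟨by omega, Nat.lt_one_iff.1 (l'.2.trans_eq (by simp only [hadj, pow_zero]))⟩

theorem TreeVertex.exists_leafPos {n h i d : ℕ} (hd : d ≤ h) {x : BPCV n h}
    (hx : TreeVertex d (i / 2 ^ (h - d)) x) :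
    LeafPos i d x ∨ LeafPos i (2 * h + 2 ^ h + i + 1 - d) x := by
  have hpow := Nat.two_pow_pos h
  rcases x with a | _ | _ | _ | ⟨e, l⟩ | ⟨e, l⟩ | ⟨j, q⟩ | q | q <;>
  simp only [TreeVertex, LeafPos] at hx ⊢
  · exact .inl ⟨hx.1, by rw [hx.2, hx.1]⟩
  · exact .inr ⟨by omega, by rw [hx.2, hx.1]⟩

theorem LeafPos.step {n h i r : ℕ} {G : SimpleGraph (Fin n)} {x₁ x₂ x₃ : Fin n} (hh : 2 ≤ h)
    (hr : h ≤ r) {x x' : BPCV n h} (hxt : x ≠ .t) (hx : LeafPos i r x)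
    (hi : i < 2 ^ h) (hadj : (bpcGraph h G x₁ x₂ x₃).Adj x x')
    (hnv : ∀ r' ≤ r, ¬ LeafPos i r' x')
    (hcut : ∀ S : BPCV n h → Prop, ¬ S .t → (∀ a b, S a → (bpcGraph h G x₁ x₂ x₃).Adj a b →
      ¬ S b → ∃ r' ≤ r, LeafPos i r' b) → ¬ S x') :
    LeafPos i (r + 1) x' := by
  have hadj := ((SimpleGraph.fromRel_adj _ _ _).1 hadj).2
  have hpow := Nat.two_pow_pos h
  rcases x with a | _ | _ | _ | ⟨d, k⟩ | ⟨d, k⟩ | ⟨j, q⟩ | q | q <;>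
  rcases x' with a' | _ | _ | _ | ⟨d', k'⟩ | ⟨d', k'⟩ | ⟨j', q'⟩ | q' | q' <;>
  simp only [LeafPos, BPCRel, or_false, false_or] at hx hadj ⊢ <;> first | omega | skip
  · exact absurd rfl hxt
  · refine absurd ⟨rfl, ?_⟩ (hnv d' (by omega))
    have hd : (d : ℕ) = d' + 1 := by omega
    have := div_two_pow_div_two (h := h) (d := d') i (by omega)
    simp only [hd] at hx
    omega
  · simp only [hadj.1, Nat.sub_self, pow_zero, Nat.div_one] at hx
    omega
  · rcases hadj with hadj | hadj
    · refine absurd ⟨hadj.1.ge, by simp only [hadj.1, Nat.sub_self, pow_zero, Nat.div_one]⟩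
        (hcut (Below (d + 1) k') id fun a b ha hab hb => ?_)
      have hb := Below.boundary (by omega) ha hab hb
      rw [show (k' : ℕ) / 2 = k by omega, hx.2] at hb
      rcases hb.exists_leafPos (by omega) with hb | hb
      · exact ⟨_, by omega, hb⟩
      · exact ⟨_, by omega, hb⟩
    · have := div_two_pow_div_two (h := h) (d := d') i (by omega)
      simp only [hadj.1] at hx
      omega
  · simp only [hadj.1, Nat.sub_self, pow_zero, Nat.div_one] at hx
    exact absurd ⟨by omega, rfl⟩ (hnv (h + 1 + q') (by omega))
  · refine hcut Middle id (fun a b ha hab hb => ?_) trivial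
    have hb : TreeVertex 0 (i / 2 ^ (h - 0)) b := by
      rw [Nat.sub_zero, Nat.div_eq_of_lt hi]
      exact ha.boundary hab hb
    rcases hb.exists_leafPos (Nat.zero_le _) with hb | hb
    · exact ⟨_, Nat.zero_le _, hb⟩
    · exact ⟨_, by omega, hb⟩
  · refine absurd ⟨hadj.1, ?_⟩ (hnv h hr)
    simp only [hadj.1, Nat.sub_self, pow_zero, Nat.div_one]
    omega
  · simp only [hadj.1, Nat.sub_self, pow_zero, Nat.div_one]
    omega
  · rcases hadj with hadj | hadj
    · omega
    · exact absurd ⟨by omega, rfl⟩ (hnv (h + 1 + q') (by omega))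

theorem LeafPos.congr {n h i i' r r' : ℕ} (hr : r ≤ h) (hr' : r' ≤ r)
    (hi : i / 2 ^ (h - r) = i' / 2 ^ (h - r)) {x : BPCV n h} (hx : LeafPos i r' x) :
    LeafPos i' r' x := by
  have hpow := Nat.two_pow_pos h
  rcases x with a | _ | _ | _ | ⟨d, k⟩ | ⟨d, k⟩ | ⟨j, q⟩ | q | q <;>
  simp only [LeafPos] at hx ⊢ <;> try omega
  refine ⟨hx.1, ?_⟩
  have key : ∀ a : ℕ, a / 2 ^ (h - d) = a / 2 ^ (h - r) / 2 ^ (r - d) := by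
    intro a
    rw [Nat.div_div_eq_div_mul, ← pow_add]
    congr 2
    omega
  rw [hx.2, key, key, hi]

/-- A path that starts by descending `T_s` continues to descend until it reaches a leaf. -/
theorem exists_leafPos_of_le {n h L : ℕ} {G : SimpleGraph (Fin n)} {x₁ x₂ x₃ : Fin n} (hh : 2 ≤ h)
    {p : ℕ → BPCV n h} (hp : IsPathFn (bpcGraph h G x₁ x₂ x₃) p L) (h0 : p 0 = BPCV.s n h)
    (hL : p L = .t) (h1 : ∃ d k, p 1 = .ts d k) (r : ℕ) (hr : r ≤ h) :
    r ≤ L ∧ ∃ i < 2 ^ h, ∀ r' ≤ r, LeafPos i r' (p r') := by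
  have hpow := Nat.two_pow_pos h
  induction r with
  | zero =>
    refine ⟨Nat.zero_le _, 0, hpow, fun r' hr' => ?_⟩
    rw [Nat.le_zero.1 hr', h0]
    exact ⟨rfl, (Nat.zero_div _).symm⟩
  | succ r ih =>
    obtain ⟨hrL, i, hi, hpos⟩ := ih (by omega)
    have hr' : r < L := by
      refine lt_of_le_of_ne hrL fun he => ?_
      have := hpos r le_rfl
      rw [he, hL] at this
      simp only [LeafPos] at this
      omega
    refine ⟨hr', ?_⟩
    have hnv := hp.not_visited hr' hpos fun _ _ _ _ => LeafPos.unique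
    have hx := hpos r le_rfl
    have hadj := ((SimpleGraph.fromRel_adj _ _ _).1 (hp.adj r hr')).2
    have hts : r = 0 → ∃ d k, p (r + 1) = .ts d k := by
      rintro rfl
      exact h1
    have key : ∃ i' < 2 ^ h, i / 2 ^ (h - r) = i' / 2 ^ (h - r) ∧
        LeafPos i' (r + 1) (p (r + 1)) := by
      generalize p r = x at hx hadj
      generalize p (r + 1) = x' at hadj hnv hts
      rcases x with a | _ | _ | _ | ⟨d, k⟩ | ⟨d, k⟩ | ⟨j, q⟩ | q | q <;>
      rcases x' with a' | _ | _ | _ | ⟨d', k'⟩ | ⟨d', k'⟩ | ⟨j', q'⟩ | q' | q' <;>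
      simp only [LeafPos, BPCRel, or_false, false_or] at hx hadj ⊢ <;> first | omega | skip
      · rcases hadj with hadj | hadj
        · have hlt : (k' : ℕ) * 2 ^ (h - d') < 2 ^ h := by
            calc (k' : ℕ) * 2 ^ (h - d') < 2 ^ (d' : ℕ) * 2 ^ (h - d') :=
                  Nat.mul_lt_mul_of_pos_right k'.2 (Nat.two_pow_pos _)
              _ = 2 ^ h := by rw [← pow_add, Nat.add_sub_cancel' (by omega)]
          have hk' : (k' : ℕ) = k' * 2 ^ (h - d') / 2 ^ (h - d') :=
            (Nat.mul_div_cancel _ (Nat.two_pow_pos _)).symm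
          refine ⟨k' * 2 ^ (h - d'), hlt, ?_, by omega, hk'⟩
          have := div_two_pow_div_two (h := h) (d := d) (k' * 2 ^ (h - d')) (by omega)
          rw [← hx.1, ← this, ← hadj.1, ← hk', ← hx.2]
          omega
        · refine absurd ⟨rfl, ?_⟩ (hnv d' (by omega))
          have := div_two_pow_div_two (h := h) (d := d') i (by omega)
          simp only [hadj.1] at hx
          omega
      · simpa using hts (by omega)
    obtain ⟨i', hi', he, hx'⟩ := key
    refine ⟨i', hi', fun r' hr' => ?_⟩
    rcases Nat.le_succ_iff.1 hr' with hr' | rfl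
    · exact (hpos r' hr').congr (by omega) hr' he
    · exact hx'

theorem exists_leafPos_of_isPathFn {n h L : ℕ} {G : SimpleGraph (Fin n)} {x₁ x₂ x₃ : Fin n}
    (hh : 2 ≤ h) {p : ℕ → BPCV n h} (hp : IsPathFn (bpcGraph h G x₁ x₂ x₃) p L)
    (h0 : p 0 = BPCV.s n h) (hL : p L = .t) (h1 : ∃ d k, p 1 = .ts d k) :
    ∃ i < 2 ^ h, L = 2 * h + 2 ^ h + i + 2 ∧ ∀ r ≤ L, LeafPos i r (p r) := by
  obtain ⟨hhL, i, hi, hpos⟩ := exists_leafPos_of_le hh hp h0 hL h1 h le_rfl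
  have key : ∀ r, h ≤ r → r ≤ L → ∀ r' ≤ r, LeafPos i r' (p r') := by
    intro r hr
    induction r, hr using Nat.le_induction with
    | base => exact fun _ => hpos
    | succ r hr ih =>
      intro hrL r' hr'
      have ih := ih (by omega)
      rcases Nat.le_succ_iff.1 hr' with hr' | rfl
      · exact ih r' hr'
      · refine (ih r le_rfl).step hh hr (fun he => ?_) hi (hp.adj r hrL)
          (hp.not_visited hrL ih fun _ _ _ _ => LeafPos.unique) fun S hS =>
          hp.not_mem_of_boundary_visited hrL ih (fun _ _ _ _ => LeafPos.unique) S (by rwa [hL])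
        have := hp.inj r (by omega) L le_rfl (he.trans hL.symm)
        omega
  have hpos := key L hhL le_rfl
  refine ⟨i, hi, ?_, hpos⟩
  have := hpos L le_rfl
  rwa [hL] at this

theorem GraphPos.step_chain {n h m r : ℕ} {y : ℕ → Fin n} {G : SimpleGraph (Fin n)}
    {x₁ x₂ x₃ : Fin n} (hh : 2 ≤ h) (hr : r < 2 ^ h + h + (2 ^ h - n)) {x x' : BPCV n h}
    (hx : GraphPos y m r x) (hadj : (bpcGraph h G x₁ x₂ x₃).Adj x x')
    (hnv : ∀ r' ≤ r, ¬ GraphPos y m r' x') (hts : r = 0 → ∀ d k, x' ≠ .ts d k) :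
    GraphPos y m (r + 1) x' := by
  have hadj := ((SimpleGraph.fromRel_adj _ _ _).1 hadj).2
  have hpow := Nat.two_pow_pos h
  rcases x with a | _ | _ | _ | ⟨d, k⟩ | ⟨d, k⟩ | ⟨j, q⟩ | q | q <;>
  rcases x' with a' | _ | _ | _ | ⟨d', k'⟩ | ⟨d', k'⟩ | ⟨j', q'⟩ | q' | q' <;>
  simp only [GraphPos, BPCRel, or_false, false_or] at hx hadj ⊢ <;> first | omega | skip
  · exact absurd rfl (hts hx.2 d' k')
  · exact absurd ⟨hadj.1, rfl⟩ (hnv 0 (Nat.zero_le _))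
  · rcases hadj with hadj | hadj
    · omega
    · exact absurd rfl (hnv (q' + 1) (by omega))

theorem GraphPos.step_v {n h m : ℕ} {y : ℕ → Fin n} {G : SimpleGraph (Fin n)}
    {x₁ x₂ x₃ : Fin n} (hh : 2 ≤ h) {x x' : BPCV n h}
    (hx : GraphPos y m (2 ^ h + h + (2 ^ h - n)) x) (hadj : (bpcGraph h G x₁ x₂ x₃).Adj x x')
    (hnv : ∀ r' ≤ 2 ^ h + h + (2 ^ h - n), ¬ GraphPos y m r' x') : x' = .orig x₁ := by
  have hadj := ((SimpleGraph.fromRel_adj _ _ _).1 hadj).2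
  have hpow := Nat.two_pow_pos h
  rcases x with a | _ | _ | _ | ⟨d, k⟩ | ⟨d, k⟩ | ⟨j, q⟩ | q | q <;>
  rcases x' with a' | _ | _ | _ | ⟨d', k'⟩ | ⟨d', k'⟩ | ⟨j', q'⟩ | q' | q' <;>
  simp only [GraphPos, BPCRel, or_false, false_or] at hx hadj ⊢ <;> first | omega | skip
  · rw [hadj]
  · exact absurd rfl (hnv (q' + 1) (by omega))

theorem TreeVertex.exists_graphPos {n h m k : ℕ} {y : ℕ → Fin n} {x : BPCV n h}
    (hx : TreeVertex 0 k x) :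
    GraphPos y m 0 x ∨ GraphPos y m (2 ^ h + h + (2 ^ h - n) + 1 + m + h) x := by
  cases x <;> simp_all [TreeVertex, GraphPos]

theorem eq_v_or_eq_u_of_adj_orig {n h : ℕ} {G : SimpleGraph (Fin n)} {x₁ x₂ x₃ a : Fin n}
    {x : BPCV n h} (hadj : (bpcGraph h G x₁ x₂ x₃).Adj (.orig a) x)
    (hx : ∀ a', x ≠ .orig a') : x = .v ∨ x = .u ∧ (a = x₂ ∨ a = x₃) := by
  have hadj := ((SimpleGraph.fromRel_adj _ _ _).1 hadj).2
  cases x <;> simp_all [BPCRel]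

theorem GraphPos.step_end {n h m r : ℕ} {y : ℕ → Fin n} {G : SimpleGraph (Fin n)}
    {x₁ x₂ x₃ : Fin n} (hh : 2 ≤ h) (hr : 2 ^ h + h + (2 ^ h - n) + 1 + m ≤ r) {x x' : BPCV n h}
    (hxt : x ≠ .t) (hx : GraphPos y m r x) (hadj : (bpcGraph h G x₁ x₂ x₃).Adj x x')
    (hnv : ∀ r' ≤ r, ¬ GraphPos y m r' x')
    (hcut : ∀ S : BPCV n h → Prop, ¬ S .t → (∀ a b, S a → (bpcGraph h G x₁ x₂ x₃).Adj a b →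
      ¬ S b → ∃ r' ≤ r, GraphPos y m r' b) → ¬ S x') :
    GraphPos y m (r + 1) x' := by
  have hadj := ((SimpleGraph.fromRel_adj _ _ _).1 hadj).2
  have hpow := Nat.two_pow_pos h
  rcases x with a | _ | _ | _ | ⟨d, k⟩ | ⟨d, k⟩ | ⟨j, q⟩ | q | q <;>
  rcases x' with a' | _ | _ | _ | ⟨d', k'⟩ | ⟨d', k'⟩ | ⟨j', q'⟩ | q' | q' <;>
  simp only [GraphPos, BPCRel, or_false, false_or] at hx hadj ⊢ <;> first | omega | skip
  · refine absurd ⟨a', rfl⟩ (hcut (fun z => ∃ a, z = .orig a) (by simp) ?_)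
    rintro _ b ⟨a, rfl⟩ hab hb
    rcases eq_v_or_eq_u_of_adj_orig hab (not_exists.1 hb) with rfl | ⟨rfl, -⟩
    · exact ⟨2 ^ h + h + (2 ^ h - n), by omega, rfl⟩
    · exact ⟨r, le_rfl, hx⟩
  · exact absurd rfl hxt
  · rcases hadj with hadj | hadj
    · refine absurd ⟨by omega, ?_⟩ (hcut (Below (0 + 1) k') id fun a b ha hab hb => ?_)
      · have hb := (Below.boundary (by omega) ha hab hb).exists_graphPos (y := y) (m := m)
        rcases hb with hb | hb
        · exact ⟨_, Nat.zero_le _, hb⟩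
        · exact ⟨_, hx.2.ge, hb⟩
      · simp only [hadj.1, hx.1, Nat.sub_self, pow_zero, Nat.div_one]
    · omega
  · exact absurd rfl (hnv _ (by omega))
  · exact absurd rfl (hnv _ (by omega))
  · rcases hadj with hadj | hadj
    · omega
    · exact absurd rfl (hnv _ (by omega))

/-- A path that does not start by descending `T_s` traces a path of `G` from `x₁` to `x₂` or
`x₃`. -/
theorem exists_graphPos_of_isPathFn {n h L : ℕ} {G : SimpleGraph (Fin n)} {x₁ x₂ x₃ : Fin n}
    (hh : 2 ≤ h) {p : ℕ → BPCV n h} (hp : IsPathFn (bpcGraph h G x₁ x₂ x₃) p L)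
    (h0 : p 0 = BPCV.s n h) (hL : p L = .t) (h1 : ∀ d k, p 1 ≠ .ts d k) :
    ∃ (y : ℕ → Fin n) (m : ℕ), L = 2 ^ h + h + (2 ^ h - n) + 2 + (m + 1) + h ∧ IsPathFn G y m ∧
      y 0 = x₁ ∧ (y m = x₂ ∨ y m = x₃) ∧ ∀ r ≤ L, GraphPos y (m + 1) r (p r) := by
  classical
  set C := 2 ^ h + h + (2 ^ h - n) with hC
  have hpow := Nat.two_pow_pos h
  have hlt : ∀ r ≤ L, p r ≠ .t → r < L := fun r hr hne =>
    lt_of_le_of_ne hr fun he => hne (by rw [he, hL])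
  have chain : ∀ (y : ℕ → Fin n) (m : ℕ), ∀ r ≤ C, r ≤ L ∧ ∀ r' ≤ r, GraphPos y m r' (p r') := by
    intro y m r
    induction r with
    | zero =>
      refine fun _ => ⟨Nat.zero_le _, fun r' hr' => ?_⟩
      rw [Nat.le_zero.1 hr', h0]
      exact ⟨rfl, rfl⟩
    | succ r ih =>
      intro hrC
      obtain ⟨hrL, hpos⟩ := ih (by omega)
      have hrL := hlt r hrL fun he => by
        have := hpos r le_rfl
        rw [he] at this
        simp only [GraphPos] at this
        omega
      refine ⟨hrL, fun r' hr' => ?_⟩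
      rcases Nat.le_succ_iff.1 hr' with hr' | rfl
      · exact hpos r' hr'
      · refine (hpos r le_rfl).step_chain hh hrC (hp.adj r hrL)
          (hp.not_visited hrL hpos fun r' hr' _ _ => GraphPos.unique hh (.inl (by omega))) ?_
        rintro rfl
        exact h1
  have hC1 : C < L ∧ p (C + 1) = .orig x₁ := by
    obtain ⟨hrL, hpos⟩ := chain (fun _ => x₁) 0 C le_rfl
    have hrL := hlt C hrL fun he => by
      have := hpos C le_rfl
      rw [he] at this
      simp only [GraphPos] at this
      omega
    exact ⟨hrL, (hpos C le_rfl).step_v hh (hp.adj C hrL)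
      (hp.not_visited hrL hpos fun r' hr' _ _ => GraphPos.unique hh (.inl (by omega)))⟩
  have hex : ∃ m, C + 1 + m + 1 ≤ L ∧ ∀ a, p (C + 1 + m + 1) ≠ .orig a := by
    have hne : L ≠ C + 1 := by
      rintro rfl
      rw [hL] at hC1
      simpa using hC1.2
    refine ⟨L - (C + 2), by omega, fun a => ?_⟩
    rw [show C + 1 + (L - (C + 2)) + 1 = L by omega, hL]
    simp
  obtain ⟨m, ⟨hmL, hm⟩, hmin⟩ : ∃ m, (C + 1 + m + 1 ≤ L ∧ ∀ a, p (C + 1 + m + 1) ≠ .orig a) ∧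
      ∀ q < m, ∃ a, p (C + 1 + q + 1) = .orig a := by
    refine ⟨Nat.find hex, Nat.find_spec hex, fun q hq => ?_⟩
    have h1 := Nat.find_min hex hq
    have h2 := (Nat.find_spec hex).1
    by_contra hcon
    exact h1 ⟨by omega, fun a ha => hcon ⟨a, ha⟩⟩
  have horig : ∀ q, ∃ a, q ≤ m → p (C + 1 + q) = .orig a := by
    intro q
    by_cases hq : q ≤ m
    · cases q with
      | zero => exact ⟨x₁, fun _ => hC1.2⟩
      | succ q =>
        obtain ⟨a, ha⟩ := hmin q (by omega)
        exact ⟨a, fun _ => ha⟩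
    · exact ⟨x₁, fun h => absurd h hq⟩
  choose y hy using horig
  have hu : p (C + 1 + m + 1) = .u ∧ (y m = x₂ ∨ y m = x₃) := by
    have hadj := hp.adj (C + 1 + m) hmL
    rw [hy m le_rfl] at hadj
    refine (eq_v_or_eq_u_of_adj_orig hadj hm).resolve_left fun hv => ?_
    exact hp.not_visited hmL (R := fun r' x => x = p r') (fun _ _ => rfl)
      (fun _ _ _ _ h h' => h.trans h'.symm) C (by omega) (by
        rw [hv]
        exact GraphPos.unique (y := y) (m := 0) (y' := y) (m' := 0) hh (.inl le_rfl) rfl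
          ((chain y 0 C le_rfl).2 C le_rfl))
  have hpath : IsPathFn G y m := by
    refine ⟨fun q hq => ?_, fun q hq q' hq' he => ?_⟩
    · have hadj := hp.adj (C + 1 + q) (by omega)
      rw [hy q hq.le, add_assoc, hy (q + 1) hq] at hadj
      rcases ((SimpleGraph.fromRel_adj _ _ _).1 hadj).2 with h | h
      · exact h
      · exact h.symm
    · have := hp.inj (C + 1 + q) (by omega) (C + 1 + q') (by omega)
        (by rw [hy q hq, hy q' hq', he])
      omega
  have hpos : ∀ r, C + 1 + m + 1 ≤ r → r ≤ L → ∀ r' ≤ r, GraphPos y (m + 1) r' (p r') := by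
    intro r hr
    induction r, hr using Nat.le_induction with
    | base =>
      intro _ r' hr'
      by_cases h1 : r' ≤ C
      · exact (chain y (m + 1) r' h1).2 r' le_rfl
      by_cases h2 : r' ≤ C + 1 + m
      · obtain ⟨q, rfl⟩ := Nat.exists_eq_add_of_le (show C + 1 ≤ r' by omega)
        rw [hy q (by omega)]
        exact ⟨q, by omega, rfl, rfl⟩
      · obtain rfl : r' = C + 1 + m + 1 := by omega
        rw [hu.1]
        rfl
    | succ r hr ih =>
      intro hrL r' hr'
      have ih := ih (by omega)
      have huniq : ∀ r' ≤ r, ∀ x x' : BPCV n h, GraphPos y (m + 1) r' x →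
          GraphPos y (m + 1) r' x' → x = x' :=
        fun _ _ _ _ => GraphPos.unique hh (.inr ⟨rfl, rfl⟩)
      rcases Nat.le_succ_iff.1 hr' with hr' | rfl
      · exact ih r' hr'
      · refine (ih r le_rfl).step_end hh hr (fun he => ?_) (hp.adj r hrL)
          (hp.not_visited hrL ih huniq) fun S hS =>
          hp.not_mem_of_boundary_visited hrL ih huniq S (by rwa [hL])
        have := hp.inj r (by omega) L le_rfl (he.trans hL.symm)
        omega
  have hpos := hpos L hmL le_rfl
  refine ⟨y, m, ?_, hpath, ?_, hu.2, hpos⟩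
  · have := hpos L le_rfl
    rwa [hL] at this
  · have := hy 0 (Nat.zero_le _)
    rw [add_zero, hC1.2] at this
    exact (BPCV.orig.inj this).symm

theorem LeafPos.eq_treeEdge {n h i : ℕ} (d : Fin (h - 1)) (k : Fin (2 ^ ((d : ℕ) + 1)))
    (hk : i / 2 ^ (h - (d + 1)) = k) {x x' : BPCV n h} (hx : LeafPos i d x)
    (hx' : LeafPos i (d + 1) x') : treeEdge n h ⟨d, k⟩ = s(x, x') := by
  refine congrArg₂ (fun a b => s(a, b)) (LeafPos.unique ⟨rfl, ?_⟩ hx)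
    (LeafPos.unique ⟨rfl, hk.symm⟩ hx')
  simp only [← hk]
  exact div_two_pow_div_two i (by omega)

theorem exists_isPathFn_of_paths {n h : ℕ} {G : SimpleGraph (Fin n)} {x₁ x₂ x₃ : Fin n}
    (hh : 2 ≤ h) (hn : n ≤ 2 ^ h) {p : Fin (2 ^ h + 1) → ℕ → BPCV n h} {L : Fin (2 ^ h + 1) → ℕ}
    (hp : ∀ i, IsPathFn (bpcGraph h G x₁ x₂ x₃) (p i) (L i) ∧ p i 0 = BPCV.s n h ∧ p i (L i) = .t)
    (hcard : (sharedEdges p L).ncard ≤ 2 ^ h - 2) :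
    ∃ y : ℕ → Fin n, IsPathFn G y (n - 1) ∧ y 0 = x₁ ∧ (y (n - 1) = x₂ ∨ y (n - 1) = x₃) := by
  have hpow := Nat.two_pow_pos h
  have key : ∀ i, ∃ c : Fin (2 ^ h + 1),
      ((c : ℕ) < 2 ^ h ∧ L i = 2 * h + 2 ^ h + c + 2 ∧ ∀ r ≤ L i, LeafPos c r (p i r)) ∨
      ((c : ℕ) = 2 ^ h ∧ ∃ (y : ℕ → Fin n) (m : ℕ),
        L i = 2 ^ h + h + (2 ^ h - n) + 2 + (m + 1) + h ∧ IsPathFn G y m ∧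
        y 0 = x₁ ∧ (y m = x₂ ∨ y m = x₃) ∧ ∀ r ≤ L i, GraphPos y (m + 1) r (p i r)) := by
    intro i
    obtain ⟨h1, h2, h3⟩ := hp i
    by_cases hts : ∃ d k, p i 1 = .ts d k
    · obtain ⟨c, hc, h⟩ := exists_leafPos_of_isPathFn hh h1 h2 h3 hts
      exact ⟨⟨c, by omega⟩, .inl ⟨hc, h⟩⟩
    · push Not at hts
      exact ⟨⟨2 ^ h, by omega⟩, .inr ⟨rfl, exists_graphPos_of_isPathFn hh h1 h2 h3 hts⟩⟩
  choose c hc using key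
  have hinj : Function.Injective c := by
    intro i j hij
    by_contra hne
    have hcj := hc j
    rw [← hij] at hcj
    rcases hc i with ⟨hi, hLi, hpi⟩ | ⟨hi, y, m, hLi, -, -, -, hpi⟩ <;>
    rcases hcj with ⟨hj, hLj, hpj⟩ | ⟨hj, y', m', hLj, -, -, -, hpj⟩
    · have := le_ncard_sharedEdges hne (hp i).1 le_rfl (by omega) fun r hr =>
        (hpi r hr).unique (hpj r (by omega))
      omega
    · omega
    · omega
    · have := le_ncard_sharedEdges (M := 2 ^ h + h + (2 ^ h - n)) hne (hp i).1 (by omega)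
        (by omega) fun r hr =>
        GraphPos.unique hh (.inl hr) (hpi r (by omega)) (hpj r (by omega))
      omega
  have hsurj : Function.Surjective c := Finite.injective_iff_surjective.1 hinj
  have hleaf : ∀ a < 2 ^ h, ∃ i, (c i : ℕ) = a ∧ L i = 2 * h + 2 ^ h + a + 2 ∧
      ∀ r ≤ L i, LeafPos a r (p i r) := by
    intro a ha
    obtain ⟨i, hi⟩ := hsurj ⟨a, by omega⟩
    have := hc i
    rw [hi] at this
    rcases this with ⟨-, h⟩ | ⟨h, -⟩
    · exact ⟨i, by rw [hi], h⟩
    · exact absurd h ha.ne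
  obtain ⟨i, hi⟩ := hsurj ⟨2 ^ h, by omega⟩
  have hci := hc i
  rw [hi] at hci
  rcases hci with ⟨h, -⟩ | ⟨-, y, m, hL, hy, hy0, hym, hpi⟩
  · exact absurd h (lt_irrefl _)
  have hmn : m + 1 ≤ n := by
    have : Function.Injective fun q : Fin (m + 1) => y q := fun q q' he =>
      Fin.ext (hy.inj q (by omega) q' (by omega) he)
    simpa using Fintype.card_le_of_injective _ this
  rcases hmn.eq_or_lt with rfl | hmn
  · exact ⟨y, hy, hy0, hym⟩
  exfalso
  obtain ⟨j, hcj, hLj, hpj⟩ := hleaf (2 ^ h - n + (m + 1)) (by omega)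
  have hij : i ≠ j := by
    rintro rfl
    rw [hi] at hcj
    simp only at hcj
    omega
  have hLL : L i = L j := by omega
  have hsub : insert s(BPCV.w n h, .t) (Set.range (treeEdge n h)) ⊆ sharedEdges p L := by
    refine Set.insert_subset ?_ ?_
    · have hwi : p i (L i - 1) = BPCV.w n h :=
        GraphPos.unique hh (.inr ⟨rfl, rfl⟩) (hpi _ (Nat.sub_le _ _)) ⟨rfl, by omega⟩
      have hwj : p j (L j - 1) = BPCV.w n h :=
        (hpj _ (Nat.sub_le _ _)).unique
          ⟨by simp only; omega, by simp only [Nat.sub_zero]; rw [Nat.div_eq_of_lt (by omega)]⟩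
      refine ⟨i, j, hij, L i - 1, ⟨by omega, ?_⟩, by omega, ?_⟩
      · rw [hwi, Nat.sub_add_cancel (by omega), (hp i).2.2]
      · rw [hLL, hwj, Nat.sub_add_cancel (by omega), (hp j).2.2]
    · rintro _ ⟨⟨d, k⟩, rfl⟩
      have h2 : 2 ≤ 2 ^ (h - (d + 1)) := by
        calc 2 = 2 ^ 1 := rfl
          _ ≤ _ := Nat.pow_le_pow_right (by omega) (by omega)
      have hlt : (k : ℕ) * 2 ^ (h - (d + 1)) + 1 < 2 ^ h := by
        have h3 : ((k : ℕ) + 1) * 2 ^ (h - (d + 1)) ≤ 2 ^ h := by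
          calc ((k : ℕ) + 1) * 2 ^ (h - (d + 1)) ≤ 2 ^ ((d : ℕ) + 1) * 2 ^ (h - (d + 1)) :=
                Nat.mul_le_mul_right _ k.2
            _ = 2 ^ h := by rw [← pow_add, Nat.add_sub_cancel' (by omega)]
        rw [Nat.succ_mul] at h3
        omega
      obtain ⟨a, hca, hLa, hpa⟩ := hleaf _ (Nat.lt_of_succ_lt hlt)
      obtain ⟨b, hcb, hLb, hpb⟩ := hleaf _ hlt
      refine ⟨a, b, fun hab => ?_, d, ⟨by omega, LeafPos.eq_treeEdge d k ?_ (hpa _ (by omega))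
        (hpa _ (by omega))⟩, by omega, LeafPos.eq_treeEdge d k ?_ (hpb _ (by omega))
        (hpb _ (by omega))⟩
      · rw [hab] at hca
        omega
      · exact Nat.mul_div_cancel _ (by omega)
      · rw [mul_comm, Nat.mul_add_div (by omega), Nat.div_eq_of_lt (by omega), add_zero]
  have hcard' := Set.ncard_le_ncard hsub (finite_sharedEdges p L)
  rw [Set.ncard_insert_of_notMem _ (Set.finite_range _), ← Set.image_univ,
    Set.ncard_image_of_injective _ (treeEdge_injective n h), Set.ncard_univ,
    Nat.card_eq_fintype_card, card_treeEdge_index h (by omega)] at hcard'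
  · omega
  · rintro ⟨σ, hσ⟩
    simp [treeEdge] at hσ

/-- A cubic graph `G` on `n` vertices (with a fixed vertex `x₁` and
distinct neighbors `x₂, x₃` of it, and `η = 2^h` the smallest power of two with
`η ≥ n`) has a Hamiltonian cycle iff the graph `G'` of the bounded-degree path
construction admits `η + 1` `s`-`t` paths sharing at most `η − 2` edges. -/
theorem stmt6 (n h : ℕ) (G : SimpleGraph (Fin n)) [DecidableRel G.Adj]
    (hcubic : ∀ x : Fin n, G.degree x = 3)
    (x₁ x₂ x₃ : Fin n) (h₂ : G.Adj x₁ x₂) (h₃ : G.Adj x₁ x₃) (h₂₃ : x₂ ≠ x₃)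
    (hη : n ≤ 2 ^ h) (hmin : ∀ h' : ℕ, n ≤ 2 ^ h' → h ≤ h') :
    (∃ (a : Fin n) (c : G.Walk a a), c.IsHamiltonianCycle) ↔
    (∃ P : Fin (2 ^ h + 1) → List (BPCV n h),
      (∀ i : Fin (2 ^ h + 1),
        IsGWalk (SimpleGraph.fromRel (BPCRel G x₁ x₂ x₃)) (P i) ∧ (P i).Nodup ∧
        (P i).head? = some (BPCV.ts ⟨0, Nat.succ_pos h⟩ ⟨0, Nat.two_pow_pos _⟩) ∧
        (P i).getLast? = some BPCV.t) ∧
      {e : Sym2 (BPCV n h) | SharedEdge P e}.ncard ≤ 2 ^ h - 2) := by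
  have hn : 4 ≤ n := by
    have := G.degree_lt_card_verts x₁
    rw [hcubic, Fintype.card_fin] at this
    exact this
  have hh : 2 ≤ h := by
    by_contra hcon
    have := Nat.pow_le_pow_right (n := 2) (by omega) (show h ≤ 1 by omega)
    omega
  rw [exists_isHamiltonianCycle_iff G x₁ x₂ x₃ (hcubic x₁) h₂ h₃ h₂₃, exists_paths_iff]
  constructor
  · rintro ⟨y, hy, hy0, hyn⟩
    exact exists_paths_of_isPathFn hh hη (by omega) hy hy0 hyn
  · rintro ⟨p, L, hp, hcard⟩
    exact exists_isPathFn_of_paths hh hη hp hcard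

end PaperRCA
end

section
/- Let G be an undirected cubic graph with n vertices and let G' be the multigraph of the trail construction. Then G has a Hamiltonian cycle if and only if G' admits 2n s-t trails sharing no edge. -/
namespace PaperRCA

/-- A walk in an undirected multigraph whose edge type is `E`, with endpoint maps
`tl, hd : E → V`: a vertex list `vs = v₀, …, v_ℓ` together with an edge list
`es = e₁, …, e_ℓ`, where the edge `e_r` joins `v_{r-1}` and `v_r`. -/
def IsUMWalk {V E : Type*} (tl hd : E → V) (vs : List V) (es : List E) : Prop :=
  vs.length = es.length + 1 ∧
  ∀ (r : ℕ) (e : E) (a b : V), es[r]? = some e → vs[r]? = some a →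
    vs[r + 1]? = some b → s(tl e, hd e) = s(a, b)

/-- An individual edge copy `e` is shared by a family of multigraph trails, given by
their edge lists, if it occurs at the same position in two distinct trails. -/
def SharedMultiEdge {E : Type*} {p : ℕ} (W : Fin p → List E) (e : E) : Prop :=
  ∃ i j : Fin p, i ≠ j ∧ ∃ r : ℕ, (W i)[r]? = some e ∧ (W j)[r]? = some e

/-- Vertices of the trail construction for a cubic graph `G` on `n` vertices:
the vertices of the subdivision `H'` of a copy of `G` (original vertices `orig x`
and one subdivision vertex `mid x y` for each edge `{x,y}` of `G`, canonically
represented with `x < y`), the new vertices `s, v, w, t`, and the vertices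
`b i` (representing `b_{i+1}` for `i : Fin (n-1)`). -/
inductive TCV (n : ℕ) where
  | orig (x : Fin n) : TCV n
  | mid (x y : Fin n) : TCV n
  | s : TCV n
  | v : TCV n
  | w : TCV n
  | t : TCV n
  | b (i : Fin (n - 1)) : TCV n

/-- Edges of the trail construction (as a multigraph): `subd x y` is the
subdivision edge joining `orig x` and the subdivision vertex of the edge `{x,y}`
of `G`; `sx, sv, vw, xw, wt` are the edges `{s,x}, {s,v}, {v,w}, {x,w}, {w,t}`
(`x` being the vertex of `H'` corresponding to the chosen vertex `x₀` of `G`);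
and `par i c` (`c : Fin 2`) are the two parallel edges joining `s` and `b i`. -/
inductive TCE (n : ℕ) where
  | subd (x y : Fin n) : TCE n
  | sx : TCE n
  | sv : TCE n
  | vw : TCE n
  | xw : TCE n
  | wt : TCE n
  | par (i : Fin (n - 1)) (c : Fin 2) : TCE n

/-- First endpoint of an edge of the trail construction. -/
def TCtl {n : ℕ} (x₀ : Fin n) : TCE n → TCV n
  | .subd x _ => .orig x
  | .sx => .s
  | .sv => .s
  | .vw => .v
  | .xw => .orig x₀
  | .wt => .w
  | .par _ _ => .s

/-- Second endpoint of an edge of the trail construction. -/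
def TChd {n : ℕ} (x₀ : Fin n) : TCE n → TCV n
  | .subd x y => .mid (min x y) (max x y)
  | .sx => .orig x₀
  | .sv => .v
  | .vw => .w
  | .xw => .w
  | .wt => .t
  | .par i _ => .b i

/-- Which formal edges actually exist in the trail construction: `subd x y` exists
iff `{x,y}` is an edge of `G`; all other edges exist. -/
def TCEOK {n : ℕ} (G : SimpleGraph (Fin n)) : TCE n → Prop
  | .subd x y => G.Adj x y
  | _ => True

/-- `EdgeChain tl hd a es b` says that `es` is the edge list of a walk from `a` to `b`. -/
def EdgeChain {V E : Type*} (tl hd : E → V) : V → List E → V → Prop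
  | a, [], b => a = b
  | a, e :: es, b => ∃ c, s(tl e, hd e) = s(a, c) ∧ EdgeChain tl hd c es b

theorem EdgeChain.append {V E : Type*} {tl hd : E → V} {es es' : List E} {a b c : V}
    (h : EdgeChain tl hd a es b) (h' : EdgeChain tl hd b es' c) :
    EdgeChain tl hd a (es ++ es') c := by
  induction es generalizing a with
  | nil => cases h; exact h'
  | cons e es ih =>
    obtain ⟨d, hd, hc⟩ := h
    exact ⟨d, hd, ih hc⟩

theorem edgeChain_iff_exists_isUMWalk {V E : Type*} {tl hd : E → V} {es : List E} {a b : V} :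
    EdgeChain tl hd a es b ↔
      ∃ vs : List V, IsUMWalk tl hd vs es ∧ vs.head? = some a ∧ vs.getLast? = some b := by
  induction es generalizing a with
  | nil =>
    constructor
    · rintro rfl
      exact ⟨[a], ⟨rfl, by simp⟩, rfl, rfl⟩
    · rintro ⟨vs, ⟨hlen, -⟩, ha, hb⟩
      obtain ⟨x, rfl⟩ := List.length_eq_one_iff.mp hlen
      simp at ha hb
      exact ha.symm.trans hb
  | cons e es ih =>
    constructor
    · rintro ⟨c, hc, h⟩
      obtain ⟨vs, ⟨hlen, hvs⟩, hhead, hlast⟩ := ih.mp h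
      refine ⟨a :: vs, ⟨by simp [hlen], ?_⟩, rfl, ?_⟩
      · rintro (_ | r) e' x y he hx hy
        · simp only [List.getElem?_cons_zero, Option.some.injEq, zero_add,
            List.getElem?_cons_succ] at he hx hy
          rw [← List.head?_eq_getElem?, hhead] at hy
          cases hy; subst he hx; exact hc
        · simp only [List.getElem?_cons_succ] at he hx hy
          exact hvs r e' x y he hx hy
      · cases vs with
        | nil => simp at hhead
        | cons y ys => simpa [List.getLast?_cons_cons] using hlast
    · rintro ⟨vs, ⟨hlen, hvs⟩, hhead, hlast⟩
      match vs, hlen with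
      | x :: y :: ys, hlen =>
        cases hhead
        refine ⟨y, hvs 0 e _ y rfl rfl rfl, ih.mpr ⟨y :: ys, ⟨by simpa using hlen, ?_⟩, rfl, ?_⟩⟩
        · intro r e' p q he hp hq
          exact hvs (r + 1) e' p q he hp hq
        · simpa [List.getLast?_cons_cons] using hlast

theorem EdgeChain.exists_mem_crossing {V E : Type*} {tl hd : E → V} {es : List E} {a b : V}
    (h : EdgeChain tl hd a es b) (S : Set V) (ha : a ∈ S) (hb : b ∉ S) :
    ∃ e ∈ es, ¬ (tl e ∈ S ↔ hd e ∈ S) := by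
  induction es generalizing a with
  | nil => cases h; exact absurd ha hb
  | cons e es ih =>
    obtain ⟨c, hc, h⟩ := h
    by_cases hcS : c ∈ S
    · obtain ⟨e', he', hS⟩ := ih h hcS
      exact ⟨e', List.mem_cons_of_mem _ he', hS⟩
    · refine ⟨e, List.mem_cons_self, ?_⟩
      rcases Sym2.eq_iff.mp hc with ⟨h1, h2⟩ | ⟨h1, h2⟩ <;> rw [h1, h2] <;> tauto

/-- The edges of the subdivided graph traversed along a walk of the original graph. -/
def subdivEdges {n : ℕ} {G : SimpleGraph (Fin n)} : {a b : Fin n} → G.Walk a b → List (TCE n)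
  | _, _, .nil => []
  | _, _, .cons (u := u) (v := v) _ p => .subd u v :: .subd v u :: subdivEdges p

section subdivEdges

variable {n : ℕ} {G : SimpleGraph (Fin n)} {a b : Fin n}

theorem length_subdivEdges (p : G.Walk a b) : (subdivEdges p).length = 2 * p.length := by
  induction p with
  | nil => rfl
  | cons h p ih => simp [subdivEdges, ih]; ring

theorem mem_subdivEdges (p : G.Walk a b) (e : TCE n) :
    e ∈ subdivEdges p ↔ ∃ x y, e = .subd x y ∧ s(x, y) ∈ p.edges := by
  induction p with
  | nil => simp [subdivEdges]
  | cons h p ih =>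
    simp only [subdivEdges, List.mem_cons, ih, SimpleGraph.Walk.edges_cons, Sym2.eq_iff]
    constructor
    · rintro (rfl | rfl | ⟨x, y, rfl, hxy⟩)
      · exact ⟨_, _, rfl, .inl (.inl ⟨rfl, rfl⟩)⟩
      · exact ⟨_, _, rfl, .inl (.inr ⟨rfl, rfl⟩)⟩
      · exact ⟨_, _, rfl, .inr hxy⟩
    · rintro ⟨x, y, rfl, (⟨rfl, rfl⟩ | ⟨rfl, rfl⟩) | hxy⟩
      · exact .inl rfl
      · exact .inr (.inl rfl)
      · exact .inr (.inr ⟨_, _, rfl, hxy⟩)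

theorem nodup_subdivEdges (p : G.Walk a b) : (subdivEdges p).Nodup ↔ p.IsTrail := by
  induction p with
  | nil => simp [subdivEdges]
  | @cons u v w h p ih =>
    have hne := h.ne
    simp only [subdivEdges, List.nodup_cons, List.mem_cons, mem_subdivEdges, ih,
      SimpleGraph.Walk.isTrail_cons, TCE.subd.injEq]
    constructor
    · rintro ⟨h1, h2, h3⟩
      exact ⟨h3, fun hp => h1 (.inr ⟨_, _, ⟨rfl, rfl⟩, hp⟩)⟩
    · rintro ⟨h1, h2⟩
      refine ⟨?_, ?_, h1⟩
      · rintro (⟨h, -⟩ | ⟨x, y, ⟨rfl, rfl⟩, hxy⟩)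
        · exact hne h
        · exact h2 hxy
      · rintro ⟨x, y, ⟨rfl, rfl⟩, hxy⟩
        exact h2 (Sym2.eq_swap ▸ hxy)

theorem edgeChain_subdivEdges (x₀ : Fin n) (p : G.Walk a b) :
    EdgeChain (TCtl x₀) (TChd x₀) (.orig a) (subdivEdges p) (.orig b) := by
  induction p with
  | nil => rfl
  | @cons u v w h p ih =>
    refine ⟨.mid (min u v) (max u v), rfl, .orig v, ?_, ih⟩
    simp only [TCtl, TChd, min_comm v u, max_comm v u]
    exact Sym2.eq_swap

end subdivEdges

section parse

variable {n : ℕ} {G : SimpleGraph (Fin n)} {x₀ : Fin n}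

theorem eq_nil_of_edgeChain_t {es : List (TCE n)}
    (h : EdgeChain (TCtl x₀) (TChd x₀) .t es .t) (hwt : TCE.wt ∉ es) : es = [] := by
  match es, h with
  | [], _ => rfl
  | e :: es, ⟨c, hc, h⟩ =>
    cases e <;> simp_all [TCtl, TChd]

theorem exists_subdivEdges_append {x : Fin n} {es : List (TCE n)}
    (h : EdgeChain (TCtl x₀) (TChd x₀) (.orig x) es .t) (hnd : es.Nodup)
    (hsx : TCE.sx ∉ es) (hok : ∀ e ∈ es, TCEOK G e) :
    ∃ p : G.Walk x x₀, es = subdivEdges p ++ [.xw, .wt] := by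
  match es, h with
  | [], h₁ => cases h₁
  | .subd y z :: [], ⟨c, hc, h₁⟩ =>
    cases h₁
    simp [TCtl, TChd] at hc
  | .subd y z :: e :: es₁, ⟨c, hc, d, hd, h₁⟩ =>
    simp only [TCtl, TChd, Sym2.eq_iff, TCV.orig.injEq, reduceCtorEq, and_false, or_false] at hc
    obtain ⟨rfl, rfl⟩ := hc
    have hadj : G.Adj y z := hok (.subd y z) List.mem_cons_self
    cases e <;> simp [TCtl, TChd] at hd
    case subd a b =>
      obtain ⟨rfl, hmin, hmax⟩ := hd
      have hab : (a = y ∧ b = z) ∨ (a = z ∧ b = y) := by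
        rcases le_total a b with h1 | h1 <;> rcases le_total y z with h2 | h2 <;>
          simp_all
      rcases hab with ⟨rfl, rfl⟩ | ⟨rfl, rfl⟩
      · simp at hnd
      · obtain ⟨p, hp⟩ := exists_subdivEdges_append h₁ hnd.of_cons.of_cons
          (fun hh => hsx (by simp [hh])) (fun e he => hok e (by simp [he]))
        exact ⟨.cons hadj p, by simp [subdivEdges, hp]⟩
  | .sx :: es₁, h₁ => simp at hsx
  | .sv :: es₁, ⟨c, hc, h₁⟩ => simp [TCtl, TChd] at hc
  | .vw :: es₁, ⟨c, hc, h₁⟩ => simp [TCtl, TChd] at hc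
  | .par i j :: es₁, ⟨c, hc, h₁⟩ => simp [TCtl, TChd] at hc
  | .wt :: es₁, ⟨c, hc, h₁⟩ => simp [TCtl, TChd] at hc
  | .xw :: [], ⟨c, hc, h₁⟩ =>
    cases h₁
    simp [TCtl, TChd] at hc
  | .xw :: e :: es₁, ⟨c, hc, d, hd, h₁⟩ =>
    simp only [TCtl, TChd, Sym2.eq_iff, TCV.orig.injEq, reduceCtorEq, and_false, or_false] at hc
    obtain ⟨rfl, rfl⟩ := hc
    cases e <;> simp [TCtl, TChd] at hd
    case vw =>
      subst hd
      obtain ⟨e, he, hcross⟩ := h₁.exists_mem_crossing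
        {y | y = .s ∨ y = .v ∨ ∃ i, y = .b i} (by simp) (by simp)
      cases e <;> simp_all [TCtl, TChd]
    case xw => simp at hnd
    case wt =>
      subst hd
      simp only [List.nodup_cons] at hnd
      obtain rfl := eq_nil_of_edgeChain_t h₁ hnd.2.1
      exact ⟨.nil, rfl⟩
termination_by es.length

theorem exists_par_append {es : List (TCE n)}
    (h : EdgeChain (TCtl x₀) (TChd x₀) .s es .t) (hnd : es.Nodup) (hok : ∀ e ∈ es, TCEOK G e) :
    ∃ (l : List (Fin (n - 1) × Fin 2)) (rest : List (TCE n)),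
      es = l.map (fun q => .par q.1 q.2) ++ rest ∧ Even l.length ∧
      (rest = [.sv, .vw, .wt] ∨
        ∃ p : G.Walk x₀ x₀, rest = .sx :: (subdivEdges p ++ [.xw, .wt])) := by
  match es, h with
  | [], h₁ => cases h₁
  | .subd y z :: es₁, ⟨c, hc, h₁⟩ => simp [TCtl, TChd] at hc
  | .vw :: es₁, ⟨c, hc, h₁⟩ => simp [TCtl, TChd] at hc
  | .xw :: es₁, ⟨c, hc, h₁⟩ => simp [TCtl, TChd] at hc
  | .wt :: es₁, ⟨c, hc, h₁⟩ => simp [TCtl, TChd] at hc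
  | .sx :: es₁, ⟨c, hc, h₁⟩ =>
    simp [TCtl, TChd] at hc
    subst hc
    obtain ⟨p, hp⟩ := exists_subdivEdges_append h₁ hnd.of_cons
      (List.nodup_cons.mp hnd).1 (fun e he => hok e (by simp [he]))
    exact ⟨[], _, rfl, by simp, .inr ⟨p, by rw [hp]⟩⟩
  | .par i j :: [], ⟨c, hc, h₁⟩ =>
    cases h₁
    simp [TCtl, TChd] at hc
  | .par i j :: e :: es₁, ⟨c, hc, d, hd, h₁⟩ =>
    simp [TCtl, TChd] at hc
    subst hc
    cases e <;> simp [TCtl, TChd] at hd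
    case par i' j' =>
      obtain ⟨rfl, rfl⟩ := hd
      obtain ⟨l, rest, hl, hev, hrest⟩ := exists_par_append h₁ hnd.of_cons.of_cons
        (fun e he => hok e (by simp [he]))
      exact ⟨(i', j) :: (i', j') :: l, rest, by simp [hl], by simpa [Nat.even_add_one] using hev,
        hrest⟩
  | .sv :: [], ⟨c, hc, h₁⟩ =>
    cases h₁
    simp [TCtl, TChd] at hc
  | .sv :: e :: [], ⟨c, hc, d, hd, h₁⟩ =>
    cases h₁
    simp [TCtl, TChd] at hc
    subst hc
    cases e <;> simp [TCtl, TChd] at hd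
  | .sv :: e :: e' :: es₁, ⟨c, hc, d, hd, d', hd', h₁⟩ =>
    simp [TCtl, TChd] at hc
    subst hc
    cases e <;> simp [TCtl, TChd] at hd
    case sv => simp at hnd
    case vw =>
      subst hd
      cases e' <;> simp [TCtl, TChd] at hd'
      case vw => simp at hnd
      case xw =>
        subst hd'
        obtain ⟨e, he, hcross⟩ := h₁.exists_mem_crossing
          {y | y ≠ .w ∧ y ≠ .v ∧ y ≠ .t} (by simp) (by simp)
        cases e <;> simp_all [TCtl, TChd]
      case wt =>
        subst hd'
        simp only [List.nodup_cons] at hnd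
        obtain rfl := eq_nil_of_edgeChain_t h₁ hnd.2.2.1
        exact ⟨[], _, rfl, by simp, .inl rfl⟩
termination_by es.length

end parse

section cubic

variable {V : Type*} [DecidableEq V] {G : SimpleGraph V}

theorem countP_mem_edges_add {a b : V} (p : G.Walk a b) (z : V) :
    p.edges.countP (z ∈ ·) + (if a = z then 1 else 0) + (if b = z then 1 else 0) =
      2 * p.support.count z := by
  induction p with
  | nil => simp [List.count_singleton]; split_ifs <;> rfl
  | @cons u v w h p ih =>
    have hne := h.ne
    simp only [SimpleGraph.Walk.edges_cons, SimpleGraph.Walk.support_cons, List.countP_cons,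
      List.count_cons, Sym2.mem_iff, decide_eq_true_eq, beq_iff_eq]
    grind

theorem countP_mem_edges_le_degree [Fintype V] [DecidableRel G.Adj] {a b : V} {p : G.Walk a b}
    (hp : p.IsTrail) (z : V) : p.edges.countP (z ∈ ·) ≤ G.degree z := by
  rw [List.countP_eq_length_filter, ← G.card_incidenceFinset_eq_degree,
    ← List.toFinset_card_of_nodup (hp.edges_nodup.filter _)]
  refine Finset.card_le_card fun e he => ?_
  simp only [List.mem_toFinset, List.mem_filter, decide_eq_true_eq] at he
  rw [SimpleGraph.mem_incidenceFinset]
  exact ⟨p.edges_subset_edgeSet he.1, he.2⟩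

theorem support_tail_nodup_of_degree_le_three [Fintype V] [DecidableRel G.Adj]
    (hdeg : ∀ x, G.degree x ≤ 3) {a : V} {p : G.Walk a a} (hp : p.IsTrail) :
    p.support.tail.Nodup := by
  rw [List.nodup_iff_count_le_one]
  intro z
  have h1 := countP_mem_edges_add p z
  have h2 := (countP_mem_edges_le_degree hp z).trans (hdeg z)
  rw [← p.cons_tail_support, List.count_cons] at h1
  simp only [beq_iff_eq] at h1
  split_ifs at h1 <;> omega

theorem isHamiltonianCycle_of_card_le_length [Fintype V] [DecidableRel G.Adj]
    (hdeg : ∀ x, G.degree x ≤ 3) {a : V} {p : G.Walk a a} (hp : p.IsTrail)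
    (hlen : Fintype.card V ≤ p.length) : p.IsHamiltonianCycle := by
  have hnd := support_tail_nodup_of_degree_le_three hdeg hp
  rw [SimpleGraph.Walk.isHamiltonianCycle_iff_isCycle_and_length_eq]
  refine ⟨⟨⟨hp, ?_⟩, hnd⟩, le_antisymm ?_ hlen⟩
  · rintro rfl
    have := Fintype.card_pos_iff.mpr ⟨a⟩
    simp at hlen
    omega
  · simpa using hnd.length_le_card

end cubic

theorem odd_length_and_isHamiltonianCycle_of_trail {n : ℕ} {G : SimpleGraph (Fin n)}
    [DecidableRel G.Adj] (hdeg : ∀ x, G.degree x ≤ 3) {x₀ : Fin n} {es : List (TCE n)}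
    (h : EdgeChain (TCtl x₀) (TChd x₀) .s es .t) (hnd : es.Nodup) (hok : ∀ e ∈ es, TCEOK G e) :
    (∃ m, es.length = 2 * m + 3) ∧ es.getLast? = some .wt ∧
      (4 * n < es.length → ∃ p : G.Walk x₀ x₀, p.IsHamiltonianCycle) := by
  have hn := x₀.pos
  obtain ⟨l, rest, rfl, ⟨k, hk⟩, hrest⟩ := exists_par_append (G := G) h hnd hok
  have hl : l.length ≤ (n - 1) * 2 := by
    simpa using (List.Nodup.of_map _ (List.nodup_append.mp hnd).1).length_le_card
  rcases hrest with rfl | ⟨p, rfl⟩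
  · refine ⟨⟨k, by simp; omega⟩, by simp, fun hlt => ?_⟩
    simp at hlt
    omega
  · refine ⟨⟨k + p.length, by simp [length_subdivEdges]; omega⟩, ?_, fun hlt => ⟨p, ?_⟩⟩
    · rw [← List.cons_append, ← List.append_assoc, List.getLast?_append]
      rfl
    · have hp : p.IsTrail := (nodup_subdivEdges p).mp
        (List.nodup_append.mp (List.nodup_append.mp hnd).2.1.of_cons).1
      refine isHamiltonianCycle_of_card_le_length hdeg hp ?_
      simp [length_subdivEdges] at hlt ⊢
      omega

theorem exists_isHamiltonianCycle_of_trails {n : ℕ} {G : SimpleGraph (Fin n)}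
    [DecidableRel G.Adj] (hdeg : ∀ x, G.degree x ≤ 3) {x₀ : Fin n} (W : Fin (2 * n) → List (TCE n))
    (hW : ∀ i, EdgeChain (TCtl x₀) (TChd x₀) .s (W i) .t ∧ (W i).Nodup ∧ ∀ e ∈ W i, TCEOK G e)
    (hshare : ∀ e, ¬ SharedMultiEdge W e) : ∃ p : G.Walk x₀ x₀, p.IsHamiltonianCycle := by
  have hn := x₀.pos
  by_contra hno
  have key := fun i =>
    odd_length_and_isHamiltonianCycle_of_trail hdeg (hW i).1 (hW i).2.1 (hW i).2.2
  choose m hm using fun i => (key i).1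
  have hlt : ∀ i, m i < 2 * n - 1 := by
    intro i
    have h1 := hm i
    have h2 := mt (key i).2.2 hno
    omega
  obtain ⟨i, j, hij, heq⟩ := Fintype.exists_ne_map_eq_of_card_lt
    (fun i => (⟨m i, hlt i⟩ : Fin (2 * n - 1))) (by simp; omega)
  have hmm : m i = m j := congrArg Fin.val heq
  refine hshare .wt ⟨i, j, hij, 2 * m i + 2, ?_, ?_⟩
  · simpa [List.getLast?_eq_getElem?, hm i] using (key i).2.1
  · simpa [List.getLast?_eq_getElem?, hm j, hmm] using (key j).2.1

/-- The edges of `k` consecutive loops at `s`, through the `b`-vertices with (cyclic) indices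
`a, a + 1, …`; the parity of `c` selects the copy by which each loop leaves `s`. -/
def parLoops {n : ℕ} [NeZero (n - 1)] (a k c : ℕ) : List (TCE n) :=
  (List.range (2 * k)).map fun r => .par (Fin.ofNat (n - 1) (a + r / 2)) (Fin.ofNat 2 (c + r))

/-- For `c = 0`, the trail with `k` loops at `s` that leaves through `v`; otherwise, the trail with
`k` loops at `s` that follows the subdivision of the closed walk `p`. -/
def loopTrail {n : ℕ} [NeZero (n - 1)] {G : SimpleGraph (Fin n)} {x₀ : Fin n}
    (p : G.Walk x₀ x₀) (k c : ℕ) : List (TCE n) :=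
  parLoops k k c ++ if c = 0 then [.sv, .vw, .wt] else .sx :: (subdivEdges p ++ [.xw, .wt])

section loopTrail

variable {n : ℕ} [NeZero (n - 1)] {G : SimpleGraph (Fin n)} {x₀ : Fin n}

theorem edgeChain_parLoops (a k c : ℕ) :
    EdgeChain (TCtl x₀) (TChd x₀) .s (parLoops a k c) .s := by
  induction k with
  | zero => rfl
  | succ k ih =>
    have h : parLoops (n := n) a (k + 1) c = parLoops a k c ++
        [.par (Fin.ofNat (n - 1) (a + k)) (Fin.ofNat 2 (c + 2 * k)),
          .par (Fin.ofNat (n - 1) (a + k)) (Fin.ofNat 2 (c + (2 * k + 1)))] := by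
      have h2 : (2 * k + 1) / 2 = k := by omega
      simp [parLoops, Nat.mul_succ, List.range_succ, h2]
    rw [h]
    exact ih.append ⟨_, rfl, .s, Sym2.eq_swap, rfl⟩

theorem edgeChain_loopTrail (p : G.Walk x₀ x₀) (k c : ℕ) :
    EdgeChain (TCtl x₀) (TChd x₀) .s (loopTrail p k c) .t := by
  refine (edgeChain_parLoops k k c).append ?_
  split_ifs
  · exact ⟨.v, rfl, .w, rfl, .t, rfl, rfl⟩
  · exact ⟨.orig x₀, rfl, (edgeChain_subdivEdges x₀ p).append ⟨.w, rfl, .t, rfl, rfl⟩⟩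

theorem TCEOK_of_mem_loopTrail {p : G.Walk x₀ x₀} {k c : ℕ} {e : TCE n}
    (he : e ∈ loopTrail p k c) : TCEOK G e := by
  cases e <;> try trivial
  case subd x y =>
    have h : s(x, y) ∈ p.edges := by
      unfold loopTrail parLoops at he
      split_ifs at he
      · simp at he
      · simpa [mem_subdivEdges] using he
    exact p.edges_subset_edgeSet h

theorem parIndex_add_left_injOn {m k k' q : ℕ} [NeZero m] (hk : 0 < k) (hk' : 0 < k')
    (hkm : k ≤ m) (hkm' : k' ≤ m) (h : Fin.ofNat m (k + q) = Fin.ofNat m (k' + q)) : k = k' := by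
  have h1 : k + q ≡ k' + q [MOD m] := congrArg Fin.val h
  refine (Nat.ModEq.add_right_cancel' q h1).eq_of_abs_lt ?_
  rw [abs_lt]
  omega

theorem nodup_parLoops {a k c : ℕ} (hk : k ≤ n - 1) : (parLoops (n := n) a k c).Nodup := by
  refine List.Nodup.map_on ?_ List.nodup_range
  intro r hr r' hr' h
  rw [List.mem_range] at hr hr'
  rw [TCE.par.injEq] at h
  have h1 : a + r / 2 ≡ a + r' / 2 [MOD n - 1] := congrArg Fin.val h.1
  have h2 : (c + r) % 2 = (c + r') % 2 := congrArg Fin.val h.2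
  have h3 : r / 2 = r' / 2 := (Nat.ModEq.add_left_cancel' a h1).eq_of_abs_lt (by
    rw [abs_lt]; omega)
  omega

theorem nodup_loopTrail {p : G.Walk x₀ x₀} (hp : p.IsTrail) {k c : ℕ} (hk : k ≤ n - 1) :
    (loopTrail p k c).Nodup := by
  refine (nodup_parLoops hk).append ?_ ?_
  · split_ifs
    · simp
    · simp [List.nodup_append, nodup_subdivEdges, hp, mem_subdivEdges]
      grind
  · unfold parLoops
    split_ifs <;> simp [List.disjoint_left, mem_subdivEdges]

theorem getElem?_loopTrail {p : G.Walk x₀ x₀} {k c r : ℕ} {e : TCE n} (hc : c < 2)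
    (h : (loopTrail p k c)[r]? = some e) :
    (r < 2 * k ∧ e = .par (Fin.ofNat (n - 1) (k + r / 2)) (Fin.ofNat 2 (c + r))) ∨
    (c = 0 ∧ (r = 2 * k ∧ e = .sv ∨ r = 2 * k + 1 ∧ e = .vw ∨ r = 2 * k + 2 ∧ e = .wt)) ∨
    (c = 1 ∧ (r = 2 * k ∧ e = .sx ∨
      (∃ q x y, r = 2 * k + 1 + q ∧ (subdivEdges p)[q]? = some e ∧ e = .subd x y) ∨
      r = 2 * k + 1 + 2 * p.length ∧ e = .xw ∨ r = 2 * k + 2 + 2 * p.length ∧ e = .wt)) := by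
  have hlen : (parLoops (n := n) k k c).length = 2 * k := by simp [parLoops]
  by_cases hr : r < 2 * k
  · rw [loopTrail, List.getElem?_append_left (hlen ▸ hr)] at h
    simp only [parLoops, List.getElem?_map, List.getElem?_range hr, Option.map_some,
      Option.some.injEq] at h
    exact .inl ⟨hr, h.symm⟩
  · obtain ⟨q, rfl⟩ := Nat.exists_eq_add_of_le (not_lt.mp hr)
    rw [loopTrail, List.getElem?_append_right (by omega), hlen, Nat.add_sub_cancel_left] at h
    refine .inr ?_
    obtain rfl | rfl : c = 0 ∨ c = 1 := by omega
    · refine .inl ⟨rfl, ?_⟩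
      match q, h with
      | 0, h | 1, h | 2, h => simpa [eq_comm] using h
    · refine .inr ⟨rfl, ?_⟩
      match q, h with
      | 0, h => exact .inl ⟨rfl, by simpa [eq_comm] using h⟩
      | q + 1, h =>
        simp only [one_ne_zero, if_false, List.getElem?_cons_succ] at h
        by_cases hq : q < 2 * p.length
        · rw [List.getElem?_append_left (by rwa [length_subdivEdges])] at h
          obtain ⟨x, y, rfl, -⟩ := (mem_subdivEdges p e).mp (List.mem_of_getElem? h)
          exact .inr (.inl ⟨q, x, y, by ring, h, rfl⟩)
        · obtain ⟨q, rfl⟩ := Nat.exists_eq_add_of_le (not_lt.mp hq)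
          rw [List.getElem?_append_right (by simp [length_subdivEdges]), length_subdivEdges,
            Nat.add_sub_cancel_left] at h
          match q, h with
          | 0, h =>
            simp only [List.getElem?_cons_zero, Option.some.injEq] at h
            exact .inr (.inr (.inl ⟨by omega, h.symm⟩))
          | 1, h =>
            simp only [List.getElem?_cons_succ, List.getElem?_cons_zero, Option.some.injEq] at h
            exact .inr (.inr (.inr ⟨by omega, h.symm⟩))

theorem loopTrail_disjoint {p : G.Walk x₀ x₀} (hp : p.IsTrail) (hlen : n ≤ p.length)
    {k c k' c' r : ℕ} {e : TCE n} (hk : k ≤ n - 1) (hk' : k' ≤ n - 1) (hc : c < 2) (hc' : c' < 2)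
    (h : (loopTrail p k c)[r]? = some e) (h' : (loopTrail p k' c')[r]? = some e) :
    k = k' ∧ c = c' := by
  have hn := x₀.pos
  rcases getElem?_loopTrail hc h with ⟨hr, rfl⟩ | ⟨rfl, h1⟩ | ⟨rfl, h1⟩ <;>
  rcases getElem?_loopTrail hc' h' with ⟨hr', he⟩ | ⟨rfl, h2⟩ | ⟨rfl, h2⟩
  · rw [TCE.par.injEq] at he
    have h2 : (c + r) % 2 = (c' + r) % 2 := congrArg Fin.val he.2
    exact ⟨parIndex_add_left_injOn (by omega) (by omega) hk hk' he.1, by omega⟩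
  case inr.inr.inr.inr =>
    rcases h1 with ⟨h1, rfl⟩ | ⟨q, x, y, rfl, hq, rfl⟩ | ⟨h1, rfl⟩ | ⟨h1, rfl⟩ <;>
    rcases h2 with ⟨h2, he⟩ | ⟨q', x', y', h2, hq', he⟩ | ⟨h2, he⟩ | ⟨h2, he⟩ <;>
    first | cases he; done | skip
    case inr.inl.inr.inl =>
      have hqlt : q < (subdivEdges p).length := (List.getElem?_eq_some_iff.mp hq).1
      have := (List.getElem?_inj hqlt ((nodup_subdivEdges p).mpr hp)).mp (hq.trans hq'.symm)
      omega
    all_goals omega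
  all_goals grind

end loopTrail

theorem exists_trails_of_isHamiltonianCycle {n : ℕ} [NeZero (n - 1)] {G : SimpleGraph (Fin n)}
    {x₀ : Fin n} {p : G.Walk x₀ x₀} (hp : p.IsHamiltonianCycle) :
    ∃ W : Fin (2 * n) → List (TCE n),
      (∀ i, EdgeChain (TCtl x₀) (TChd x₀) .s (W i) .t ∧ (W i).Nodup ∧ ∀ e ∈ W i, TCEOK G e) ∧
      ∀ e, ¬ SharedMultiEdge W e := by
  have hlen : p.length = n := by simpa using hp.length_eq
  refine ⟨fun i => loopTrail p (i / 2) (i % 2), fun i => ⟨edgeChain_loopTrail p _ _,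
    nodup_loopTrail hp.isTrail (by omega), fun e => TCEOK_of_mem_loopTrail⟩, ?_⟩
  rintro e ⟨i, j, hij, r, hi, hj⟩
  have := loopTrail_disjoint hp.isTrail hlen.ge (by omega) (by omega) (by omega) (by omega) hi hj
  exact hij (Fin.ext (by omega))

/-- A cubic graph `G` on `n` vertices has a Hamiltonian cycle iff
the multigraph `G'` of the trail construction admits `2n` `s`-`t` trails sharing
no edge. -/
theorem stmt7 (n : ℕ) (G : SimpleGraph (Fin n)) [DecidableRel G.Adj]
    (hcubic : ∀ x : Fin n, G.degree x = 3) (x₀ : Fin n) :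
    (∃ (a : Fin n) (c : G.Walk a a), c.IsHamiltonianCycle) ↔
    (∃ W : Fin (2 * n) → List (TCV n) × List (TCE n),
      (∀ i : Fin (2 * n),
        IsUMWalk (TCtl x₀) (TChd x₀) (W i).1 (W i).2 ∧
        (∀ e ∈ (W i).2, TCEOK G e) ∧
        (W i).2.Nodup ∧
        (W i).1.head? = some TCV.s ∧ (W i).1.getLast? = some TCV.t) ∧
      ∀ e : TCE n, ¬ SharedMultiEdge (fun i => (W i).2) e) := by
  have hn : 3 < n := by simpa [hcubic x₀] using G.degree_lt_card_verts x₀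
  have : NeZero (n - 1) := ⟨by omega⟩
  constructor
  · rintro ⟨a, c, hc⟩
    obtain ⟨W, hW, hshare⟩ :=
      exists_trails_of_isHamiltonianCycle (p := c.rotate x₀ (hc.mem_support x₀)) (by simpa using hc)
    choose vs hvs using fun i => edgeChain_iff_exists_isUMWalk.mp (hW i).1
    exact ⟨fun i => (vs i, W i), fun i => ⟨(hvs i).1, (hW i).2.2, (hW i).2.1, (hvs i).2⟩, hshare⟩
  · rintro ⟨W, hW, hshare⟩
    obtain ⟨p, hp⟩ := exists_isHamiltonianCycle_of_trails (fun x => (hcubic x).le)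
      (fun i => (W i).2) (fun i => ⟨edgeChain_iff_exists_isUMWalk.mpr
        ⟨(W i).1, (hW i).1, (hW i).2.2.2⟩, (hW i).2.2.1, (hW i).2.1⟩) hshare
    exact ⟨x₀, p, hp⟩

end PaperRCA
end
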